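/- Let (X, ρ, 𝒞) be a semi-Cartan graph with GRS Δ, Weyl groupoid 𝒲, groupoid 𝒲̃, and nil-Hecke algebra 𝒩 over 𝕂 = ℤ[t_1,…,t_θ], with the map Ψ : 𝒲̃ → End_ℤ(𝒩). Let w ∈ 𝒲(y,x) with ℓ(w) = r > 0 and reduced expression w = σ_{i_1}^{x_1} σ_{i_2}^{x_2} ⋯ σ_{i_r}^{x_r} (x_1 = x). Let Θ(x; i_1,…,i_r) be the set of all u ∈ 𝒲(y,x) such that u = σ_{i_{a(1)}}^x σ_{i_{a(2)}} ⋯ σ_{i_{a(t)}} with ℓ(u) = t for some (y,x)-good subsequence a(1) < ⋯ < a(t) of 1,…,r. Then Ψ(σ̃_{i_1}^x σ̃_{i_2} ⋯ σ̃_{i_r})(1) = Σ_{u ∈ Θ(x; i_1,…,i_r)} f_u T_u, where each f_u ∈ ℤ[t_1,…,t_θ] is a nonzero polynomial all of whose coefficients are nonnegative. In particular, Θ(x; i_1,…,i_r) is exactly the set of u for which T_u appears with nonzero coefficient in Ψ(σ̃_{i_1}^x ⋯ σ̃_{i_r})(1). -/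

import Mathlib

open CategoryTheory

noncomputable section

namespace WeylGroupoid

variable {θ : ℕ} {X : Type} [Fintype X] [DecidableEq X]

/-- A *semi-Cartan graph*: a basic datum `(X, ρ)` together with a compatible bundle of
generalized Cartan matrices. -/
structure SCG (θ : ℕ) (X : Type) [Fintype X] [DecidableEq X] : Type where
  nonempty : Nonempty X
  /-- the involutions `ρ_i` of the basic datum -/
  ρ : Fin θ → X → X
  invol : ∀ i x, ρ i (ρ i x) = x
  /-- the bundle of generalized Cartan matrices `C^x` -/
  C : X → Fin θ → Fin θ → ℤ
  diag : ∀ x i, C x i i = 2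
  offdiag : ∀ x i j, i ≠ j → C x i j ≤ 0
  zero_iff : ∀ x i j, i ≠ j → (C x i j = 0 ↔ C x j i = 0)
  compat : ∀ x i j, C (ρ i x) i j = C x i j

/-- the simple root `α_i ∈ ℤ^θ` -/
def al (θ : ℕ) (i : Fin θ) : Fin θ → ℤ := Pi.single i 1

/-- the reflection `s_i^x` of `ℤ^θ`, `s_i^x (α_j) = α_j - c^x_{ij} α_i` -/
def srefl (G : SCG θ X) (x : X) (i : Fin θ) (v : Fin θ → ℤ) : Fin θ → ℤ :=
  fun k => v k - (if k = i then ∑ j, G.C x i j * v j else 0)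

/-- the cone `ℕ₀ α_i + ℕ₀ α_j` -/
def pairCone (θ : ℕ) (i j : Fin θ) : Set (Fin θ → ℤ) :=
  {v | ∃ a b : ℕ, v = (a : ℤ) • al θ i + (b : ℤ) • al θ j}

/-- A *generalized root system* on a semi-Cartan graph. -/
structure GRS (G : SCG θ X) : Type where
  /-- the root sets `Δ^x` -/
  Δ : X → Set (Fin θ → ℤ)
  pos_neg : ∀ x, Δ x = (Δ x ∩ {v | ∀ k, 0 ≤ v k}) ∪ (-(Δ x ∩ {v | ∀ k, 0 ≤ v k}))
  simple : ∀ x i, Δ x ∩ {v | ∃ c : ℤ, v = c • al θ i} = {al θ i, -al θ i}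
  reflect : ∀ x i, (srefl G x i) '' Δ x = Δ (G.ρ i x)
  pairFinite : ∀ x i j, (Δ x ∩ pairCone θ i j).Finite
  loop : ∀ x i j, (fun y => G.ρ i (G.ρ j y))^[(Δ x ∩ pairCone θ i j).ncard] x = x

variable (G : SCG θ X)

/-- The entries `m^x_{ij} = |Δ^x ∩ (ℕ₀α_i + ℕ₀α_j)|`. -/
def mnum (R : GRS G) (x : X) (i j : Fin θ) : ℕ := (R.Δ x ∩ pairCone θ i j).ncard

/-- the set of positive roots `Δ^x_+` -/
def posRoots (R : GRS G) (x : X) : Set (Fin θ → ℤ) := R.Δ x ∩ {v | ∀ k, 0 ≤ v k}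

/-- The objects of the Weyl groupoid (a type synonym for `X` carrying a quiver
structure depending on `G`). -/
def Obj (G : SCG θ X) : Type := X

instance : Quiver (Obj G) := ⟨fun a b => {i : Fin θ // G.ρ i (show X from b) = (show X from a)}⟩

/-- objects of the path category -/
def pob (x : X) : Paths (Obj G) := (x : X)

/-- the generating arrow `σ_i^x : ρ_i(x) → x` -/
def genArrow (x : X) (i : Fin θ) : pob G (G.ρ i x) ⟶ pob G x :=
  Quiver.Path.nil.cons (⟨i, rfl⟩ : (show Obj G from G.ρ i x) ⟶ (show Obj G from x))

/-- the source of the word `σ_{i_1}^x σ_{i_2} ⋯ σ_{i_m}` (with target `x`) -/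
def wsrc (G : SCG θ X) : List (Fin θ) → X → X
  | [], x => x
  | i :: l, x => wsrc G l (G.ρ i x)

/-- the path `σ_{i_1}^x σ_{i_2} ⋯ σ_{i_m} : wsrc(w,x) → x` in the free category -/
def pathOf (G : SCG θ X) : (w : List (Fin θ)) → (x : X) → (pob G (wsrc G w x) ⟶ pob G x)
  | [], _ => 𝟙 _
  | i :: l, x => (pathOf G l (G.ρ i x)) ≫ genArrow G x i


/-- transport a path along an equality of sources -/
def castSrc {a b c : X} (h : a = b) (f : pob G a ⟶ pob G c) : pob G b ⟶ pob G c := by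
  subst h; exact f

/-- the alternating word `[i, j, i, j, …]` of length `n` -/
def altWord (i j : Fin θ) : ℕ → List (Fin θ)
  | 0 => []
  | n + 1 => i :: altWord j i n

/-- The defining relations `(σ_i^x σ_j)^{m^x_{ij}} = id_x` of the Weyl groupoid. -/
inductive wrel (R : GRS G) : HomRel (Paths (Obj G))
  | rel (x : X) (i j : Fin θ)
      (h : wsrc G (altWord i j (2 * mnum G R x i j)) x = x) :
      wrel R (castSrc G h (pathOf G (altWord i j (2 * mnum G R x i j)) x))
        (𝟙 (pob G x))

variable (R : GRS G)

/-- The Weyl groupoid, as the quotient of the free category on the quiver of the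
`σ_i^x` by the relations `(σ_i^x σ_j)^{m^x_{ij}} = id_x` (every generator is invertible
in this quotient, so it is indeed a groupoid). -/
def W := CategoryTheory.Quotient (wrel G R)

instance : Category (W G R) := inferInstanceAs (Category (CategoryTheory.Quotient (wrel G R)))

/-- objects of the Weyl groupoid -/
def objW (x : X) : W G R := ⟨pob G x⟩

/-- hom-sets `𝒲(y, x)` of the Weyl groupoid -/
def homW (y x : X) := objW G R y ⟶ objW G R x

instance {y x : X} : CoeSort (homW G R y x) (objW G R y ⟶ objW G R x) := ⟨id⟩

/-- the morphism of the Weyl groupoid defined by the word `σ_{i_1}^x ⋯ σ_{i_m}` -/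
def morW (w : List (Fin θ)) (x : X) : homW G R (wsrc G w x) x :=
  (Quotient.functor (wrel G R)).map (pathOf G w x)

/-- the generator `σ_i^x : ρ_i(x) → x` in the Weyl groupoid -/
def genW (x : X) (i : Fin θ) : homW G R (G.ρ i x) x :=
  (Quotient.functor (wrel G R)).map (genArrow G x i)

/-- transport a morphism of the Weyl groupoid along an equality of sources -/
def castW {a b c : X} (h : a = b) (f : homW G R a c) : homW G R b c := by
  subst h; exact f

/-- transport a morphism of the Weyl groupoid along an equality of targets -/
def castTgt {a c c' : X} (h : c = c') (f : homW G R a c) : homW G R a c' := by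
  subst h; exact f

/-- the length `ℓ(f)` of a morphism of the Weyl groupoid -/
def len {y x : X} (f : homW G R y x) : ℕ :=
  sInf {n | ∃ w : List (Fin θ), w.length = n ∧
    ∃ h : wsrc G w x = y, castW G R h (morW G R w x) = f}

/-- `w` is a reduced expression of the morphism `f ∈ 𝒲(y,x)` -/
def IsRedEx (w : List (Fin θ)) {y x : X} (f : homW G R y x) : Prop :=
  ∃ h : wsrc G w x = y, castW G R h (morW G R w x) = f ∧ w.length = len G R f


section NilHecke

variable (𝕂 : Type) [CommRing 𝕂]

/-- the generator `e^x` of the free algebra -/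
def eF (x : X) : FreeAlgebra 𝕂 (X ⊕ X × Fin θ) := FreeAlgebra.ι 𝕂 (Sum.inl x)

/-- the generator `n_i^x` of the free algebra -/
def nF (x : X) (i : Fin θ) : FreeAlgebra 𝕂 (X ⊕ X × Fin θ) := FreeAlgebra.ι 𝕂 (Sum.inr (x, i))

/-- the word `n_{i_1}^x n_{i_2} ⋯ n_{i_m}` in the free algebra
(superscripts determined by composability) -/
def nWF (G : SCG θ X) (𝕂 : Type) [CommRing 𝕂] :
    List (Fin θ) → X → FreeAlgebra 𝕂 (X ⊕ X × Fin θ)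
  | [], _ => 1
  | i :: l, x => nF 𝕂 x i * nWF G 𝕂 l (G.ρ i x)

/-- The defining relations of the nil-Hecke algebra of `(X, ρ, 𝒞)`. -/
inductive nrel (R : GRS G) (𝕂 : Type) [CommRing 𝕂] :
    FreeAlgebra 𝕂 (X ⊕ X × Fin θ) → FreeAlgebra 𝕂 (X ⊕ X × Fin θ) → Prop
  | orth (x y : X) (h : x ≠ y) : nrel R 𝕂 (eF 𝕂 x * eF 𝕂 y) 0
  | idem (x : X) : nrel R 𝕂 (eF 𝕂 x * eF 𝕂 x) (eF 𝕂 x)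
  | total : nrel R 𝕂 (∑ x : X, eF 𝕂 x) 1
  | unit_right (x : X) (i : Fin θ) : nrel R 𝕂 (nF 𝕂 x i * eF 𝕂 (G.ρ i x)) (nF 𝕂 x i)
  | unit_left (x : X) (i : Fin θ) : nrel R 𝕂 (eF 𝕂 x * nF 𝕂 x i) (nF 𝕂 x i)
  | nil (x : X) (i : Fin θ) : nrel R 𝕂 (nF 𝕂 (G.ρ i x) i * nF 𝕂 x i) 0
  | braid (x : X) (i j : Fin θ) (hij : i ≠ j) :
      nrel R 𝕂 (nWF G 𝕂 (altWord i j (mnum G R x i j)) x)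
        (nWF G 𝕂 (altWord j i (mnum G R x i j)) x)

/-- The nil-Hecke algebra `𝒩(X, ρ, 𝒞)` of a Weyl groupoid over `𝕂`. -/
def NH := RingQuot (nrel G R 𝕂)

instance : Ring (NH G R 𝕂) := inferInstanceAs (Ring (RingQuot (nrel G R 𝕂)))
instance : Algebra 𝕂 (NH G R 𝕂) := inferInstanceAs (Algebra 𝕂 (RingQuot (nrel G R 𝕂)))

/-- the generator `e^x` of the nil-Hecke algebra -/
def eN (x : X) : NH G R 𝕂 := RingQuot.mkAlgHom 𝕂 (nrel G R 𝕂) (eF 𝕂 x)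

/-- the generator `n_i^x` of the nil-Hecke algebra -/
def nN (x : X) (i : Fin θ) : NH G R 𝕂 := RingQuot.mkAlgHom 𝕂 (nrel G R 𝕂) (nF 𝕂 x i)

/-- the word `n_{i_1}^x n_{i_2} ⋯ n_{i_m}` in the nil-Hecke algebra -/
def nW (w : List (Fin θ)) (x : X) : NH G R 𝕂 := RingQuot.mkAlgHom 𝕂 (nrel G R 𝕂) (nWF G 𝕂 w x)

/-- the set of morphisms of the Weyl groupoid -/
def Mor := Σ (y : X) (x : X), homW G R y x

/-- the free `𝕂`-module `𝕂𝒲` on the set of morphisms of the Weyl groupoid -/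
abbrev KW := Mor G R →₀ 𝕂

/-- the endomorphism `E^x` of `𝕂𝒲` -/
def Emap (x : X) : KW G R 𝕂 →ₗ[𝕂] KW G R 𝕂 :=
  Finsupp.lift (KW G R 𝕂) 𝕂 (Mor G R)
    (fun m => if m.2.1 = x then Finsupp.single m 1 else 0)

/-- the value of the endomorphism `L_i^x` of `𝕂𝒲` on a basis morphism -/
def Lval (x : X) (i : Fin θ) (m : Mor G R) : KW G R 𝕂 :=
  if h : m.2.1 = G.ρ i x then
    (let f' : homW G R m.1 x := castTgt G R h m.2.2 ≫ genW G R x i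
     if len G R m.2.2 < len G R f' then Finsupp.single ⟨m.1, x, f'⟩ 1 else 0)
  else 0

/-- the endomorphism `L_i^x` of `𝕂𝒲` -/
def Lmap (x : X) (i : Fin θ) : KW G R 𝕂 →ₗ[𝕂] KW G R 𝕂 :=
  Finsupp.lift (KW G R 𝕂) 𝕂 (Mor G R) (Lval G R 𝕂 x i)

end NilHecke

end WeylGroupoid


namespace WeylGroupoid

variable {θ : ℕ} {X : Type} [Fintype X] [DecidableEq X]

/-- The ring automorphism of `𝕂 = ℤ[t_1,…,t_θ]` induced by the reflection `s_i^x`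
(via the identification `α_i ↦ t_i`): `t_j ↦ t_j - c^x_{ij} t_i`. -/
def sAct (G : SCG θ X) (x : X) (i : Fin θ) :
    MvPolynomial (Fin θ) ℤ →+* MvPolynomial (Fin θ) ℤ :=
  (MvPolynomial.aeval fun j => MvPolynomial.X j - MvPolynomial.C (G.C x i j) * MvPolynomial.X i :
    MvPolynomial (Fin θ) ℤ →ₐ[ℤ] MvPolynomial (Fin θ) ℤ).toRingHom

/-- the linear polynomial attached to `v ∈ ℤ^θ` under `α_i ↦ t_i` -/
def lin {θ : ℕ} (v : Fin θ → ℤ) : MvPolynomial (Fin θ) ℤ := ∑ k, MvPolynomial.C (v k) * MvPolynomial.X k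

/-- `h_i^x(t) = e^x + t n_i^x` if `ρ_i(x) = x`, and `h_i^x(t) = t n_i^x` otherwise. -/
def hGen (G : SCG θ X) (R : GRS G) (x : X) (i : Fin θ) (t : MvPolynomial (Fin θ) ℤ) :
    NH G R (MvPolynomial (Fin θ) ℤ) :=
  if G.ρ i x = x then eN G R _ x + t • nN G R _ x i else t • nN G R _ x i

/-- The product `h_{i_1}^{x_1}(s·t_{i_1}) h_{i_2}^{x_2}((s∘s_{i_1}^{x_1})·t_{i_2}) ⋯`;
with `s = id` this is
`h_{i_1}^{x_1}(t_{i_1}) h_{i_2}^{x_2}(s_{i_1}^{x_1}·t_{i_2}) ⋯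
 h_{i_m}^{x_m}(s_{i_1}^{x_1}⋯s_{i_{m-1}}·t_{i_m})`,
where `x_{k+1} = ρ_{i_k}(x_k)`. -/
def hP (G : SCG θ X) (R : GRS G) :
    List (Fin θ) → X → (MvPolynomial (Fin θ) ℤ →+* MvPolynomial (Fin θ) ℤ) →
      NH G R (MvPolynomial (Fin θ) ℤ)
  | [], _, _ => 1
  | i :: l, x, s => hGen G R x i (s (MvPolynomial.X i)) * hP G R l (G.ρ i x) (s.comp (sAct G x i))

/-- the composite ring automorphism `s_{i_1}^{x_1} s_{i_2}^{x_2} ⋯ s_{i_m}^{x_m}` of `𝕂`,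
where `x_{k+1} = ρ_{i_k}(x_k)` -/
def sComp (G : SCG θ X) :
    List (Fin θ) → X → (MvPolynomial (Fin θ) ℤ →+* MvPolynomial (Fin θ) ℤ)
  | [], _ => RingHom.id _
  | i :: l, x => (sAct G x i).comp (sComp G l (G.ρ i x))

end WeylGroupoid

namespace WeylGroupoid

variable {θ : ℕ} {X : Type} [Fintype X] [DecidableEq X] (G : SCG θ X) (R : GRS G)

/-- The braid relations alone (the relations `σ̃_i^x σ̃_i^{ρ_i(x)} = id_x` are omitted),
defining the groupoid `𝒲̃` covering the Weyl groupoid. -/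
inductive trel : HomRel (Paths (Obj G))
  | braid (x : X) (i j : Fin θ) (hij : i ≠ j)
      (h : wsrc G (altWord j i (mnum G R x i j)) x =
        wsrc G (altWord i j (mnum G R x i j)) x) :
      trel (pathOf G (altWord i j (mnum G R x i j)) x)
        (castSrc G h (pathOf G (altWord j i (mnum G R x i j)) x))

/-- The groupoid `𝒲̃`: the quotient of the free category on the quiver of the `σ̃_i^x`
by the braid relations only. -/
def Wt := CategoryTheory.Quotient (trel G R)

instance : Category (Wt G R) := inferInstanceAs (Category (CategoryTheory.Quotient (trel G R)))

/-- objects of `𝒲̃` -/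
def objWt (x : X) : Wt G R := ⟨pob G x⟩

/-- hom-sets of `𝒲̃` -/
def homWt (y x : X) := objWt G R y ⟶ objWt G R x

/-- the morphism `σ̃_{i_1}^x ⋯ σ̃_{i_m}` of `𝒲̃` defined by a word -/
def morWt (w : List (Fin θ)) (x : X) : homWt G R (wsrc G w x) x :=
  (Quotient.functor (trel G R)).map (pathOf G w x)

end WeylGroupoid

namespace WeylGroupoid

variable {θ : ℕ} {X : Type} [Fintype X] [DecidableEq X]

/-- the subword of `w` given by a set of positions -/
def subword (w : List (Fin θ)) (s : Finset (Fin w.length)) : List (Fin θ) :=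
  ((List.finRange w.length).filter (fun k => k ∈ s)).map w.get

/-- A subsequence (set of positions) of a reduced expression with target `x` is
`(y,x)`-good if at every skipped position the object stays unchanged
(`x_{z+1} = x_z`). -/
def IsGood (G : SCG θ X) (w : List (Fin θ)) (x : X) (s : Finset (Fin w.length)) : Prop :=
  ∀ z : Fin w.length, z ∉ s →
    wsrc G (w.take ((z : ℕ) + 1)) x = wsrc G (w.take (z : ℕ)) x

/-- The set `Θ(x; i_1, …, i_r)` of all morphisms `u ∈ 𝒲(y,x)` obtained as reduced
products over `(y,x)`-good subsequences of the word `w = (i_1, …, i_r)`. -/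
def Theta (G : SCG θ X) (R : GRS G) (w : List (Fin θ)) (x : X) :
    Set (homW G R (wsrc G w x) x) :=
  {u | ∃ s : Finset (Fin w.length), IsGood G w x s ∧ s.card = len G R u ∧
    ∃ h : wsrc G (subword w s) x = wsrc G w x,
      castW G R h (morW G R (subword w s) x) = u}

end WeylGroupoid

namespace WeylGroupoid

variable {θ : ℕ} {X : Type} [Fintype X] [DecidableEq X]

/-! ### Reflections and the linear action of words -/

section Reflections

variable (G : SCG θ X)

lemma srefl_apply_of_ne (x : X) {i k : Fin θ} (h : k ≠ i) (v : Fin θ → ℤ) :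
    srefl G x i v k = v k := by
  simp [srefl, h]

lemma srefl_eq (x : X) (i : Fin θ) (v : Fin θ → ℤ) :
    srefl G x i v = v - (∑ j, G.C x i j * v j) • al θ i := by
  ext k
  by_cases h : k = i
  · subst h; simp [srefl, al]
  · simp [srefl, al, h]

/-- The reflection `s_i^x` as a linear endomorphism. -/
def reflLin (x : X) (i : Fin θ) : Module.End ℤ (Fin θ → ℤ) where
  toFun := srefl G x i
  map_add' u v := by
    simp only [srefl_eq, Pi.add_apply, mul_add, Finset.sum_add_distrib, add_smul]
    abel
  map_smul' c v := by
    simp only [srefl_eq, Pi.smul_apply, smul_eq_mul, RingHom.id_apply, smul_sub, smul_smul,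
      Finset.mul_sum, mul_left_comm]

@[simp] lemma reflLin_apply (x : X) (i : Fin θ) (v : Fin θ → ℤ) :
    reflLin G x i v = srefl G x i v := rfl

@[simp] lemma srefl_al (x : X) (i : Fin θ) : srefl G x i (al θ i) = -al θ i := by
  rw [srefl_eq]
  have : ∑ j, G.C x i j * al θ i j = 2 := by
    simp [al, Pi.single_apply, G.diag]
  rw [this, two_smul]; abel

@[simp] lemma srefl_rho (x : X) (i : Fin θ) : srefl G (G.ρ i x) i = srefl G x i := by
  ext v k
  simp [srefl, G.compat]

@[simp] lemma srefl_srefl (x : X) (i : Fin θ) (v : Fin θ → ℤ) :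
    srefl G x i (srefl G x i v) = v := by
  have h := (reflLin G x i).map_sub v ((∑ j, G.C x i j * v j) • al θ i)
  simp only [map_smul, reflLin_apply, srefl_al] at h
  conv_lhs => rw [srefl_eq G x i v]
  rw [h, srefl_eq]
  simp

lemma srefl_injective (x : X) (i : Fin θ) : Function.Injective (srefl G x i) :=
  Function.LeftInverse.injective (srefl_srefl G x i)

/-- The linear map `s_{i_1}^x s_{i_2} ⋯ s_{i_m}` attached to a word. -/
def wordAct : List (Fin θ) → X → Module.End ℤ (Fin θ → ℤ)
  | [], _ => 1
  | i :: l, x => reflLin G x i * wordAct l (G.ρ i x)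

@[simp] lemma wordAct_nil (x : X) (v : Fin θ → ℤ) : wordAct G [] x v = v := rfl

@[simp] lemma wordAct_cons (i : Fin θ) (l : List (Fin θ)) (x : X) (v : Fin θ → ℤ) :
    wordAct G (i :: l) x v = srefl G x i (wordAct G l (G.ρ i x) v) := rfl

lemma wordAct_append (p q : List (Fin θ)) (x : X) (v : Fin θ → ℤ) :
    wordAct G (p ++ q) x v = wordAct G p x (wordAct G q (wsrc G p x) v) := by
  induction p generalizing x with
  | nil => rfl
  | cons i p ih => simp [ih, wsrc]

lemma wordAct_injective (w : List (Fin θ)) (x : X) : Function.Injective (wordAct G w x) := by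
  induction w generalizing x with
  | nil => exact fun _ _ h => h
  | cons i l ih => exact (srefl_injective G x i).comp (ih _)

lemma wordAct_apply_of_notMem {w : List (Fin θ)} {k : Fin θ} (hk : k ∉ w) (x : X)
    (v : Fin θ → ℤ) : wordAct G w x v k = v k := by
  induction w generalizing x with
  | nil => rfl
  | cons i l ih =>
    simp only [List.mem_cons, not_or] at hk
    rw [wordAct_cons, srefl_apply_of_ne G x hk.1, ih hk.2]

end Reflections

lemma al_nonneg (i : Fin θ) : 0 ≤ al θ i := Pi.single_nonneg.2 zero_le_one

lemma al_ne_zero (i : Fin θ) : al θ i ≠ 0 := Pi.single_ne_zero_iff.2 one_ne_zero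

lemma not_neg_al_nonneg (i : Fin θ) : ¬ 0 ≤ -al θ i := fun h =>
  al_ne_zero i (le_antisymm (neg_nonneg.1 h) (al_nonneg i))

/-! ### Roots -/

section Roots

variable {G : SCG θ X} (R : GRS G)

lemma GRS.nonneg_or_nonpos {x : X} {v : Fin θ → ℤ} (h : v ∈ R.Δ x) : 0 ≤ v ∨ v ≤ 0 := by
  rw [R.pos_neg x] at h
  rcases h with h | h
  · exact Or.inl h.2
  · exact Or.inr (neg_nonneg.1 h.2)

lemma GRS.al_mem (x : X) (i : Fin θ) : al θ i ∈ R.Δ x := by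
  have h : al θ i ∈ R.Δ x ∩ {v | ∃ c : ℤ, v = c • al θ i} := by
    rw [R.simple]; simp
  exact h.1

lemma GRS.ne_zero {x : X} {v : Fin θ → ℤ} (h : v ∈ R.Δ x) (i : Fin θ) : v ≠ 0 := by
  rintro rfl
  have h' : (0 : Fin θ → ℤ) ∈ R.Δ x ∩ {v | ∃ c : ℤ, v = c • al θ i} := ⟨h, 0, by simp⟩
  rw [R.simple] at h'
  rcases h' with h' | h'
  · exact al_ne_zero i h'.symm
  · exact al_ne_zero i (neg_eq_zero.1 (Eq.symm h'))

lemma GRS.srefl_mem {x : X} (i : Fin θ) {v : Fin θ → ℤ} (h : v ∈ R.Δ x) :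
    srefl G x i v ∈ R.Δ (G.ρ i x) := R.reflect x i ▸ Set.mem_image_of_mem _ h

lemma GRS.srefl_mem_iff {x : X} {i : Fin θ} {v : Fin θ → ℤ} :
    srefl G x i v ∈ R.Δ x ↔ v ∈ R.Δ (G.ρ i x) := by
  constructor
  · intro h
    simpa using R.srefl_mem i h
  · intro h
    simpa [G.invol] using R.srefl_mem i h

lemma GRS.wordAct_mem_iff {w : List (Fin θ)} {x : X} {v : Fin θ → ℤ} :
    wordAct G w x v ∈ R.Δ x ↔ v ∈ R.Δ (wsrc G w x) := by
  induction w generalizing x with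
  | nil => rfl
  | cons i l ih => rw [wordAct_cons, R.srefl_mem_iff, ih, wsrc]

/-- The reflection `s_i` keeps a positive root different from `α_i` positive. -/
lemma GRS.srefl_nonneg {x y : X} {i : Fin θ} {v : Fin θ → ℤ} (h : v ∈ R.Δ x)
    (h' : srefl G y i v ∈ R.Δ y)
    (h0 : 0 ≤ v) (hv : v ≠ al θ i) : 0 ≤ srefl G y i v := by
  by_cases hk : ∃ k, k ≠ i ∧ v k ≠ 0
  · obtain ⟨k, hki, hk⟩ := hk
    refine (R.nonneg_or_nonpos h').resolve_right fun hn => hk (le_antisymm ?_ (h0 k))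
    simpa [srefl_apply_of_ne G y hki] using hn k
  · push Not at hk
    have h1 : v ∈ R.Δ x ∩ {v | ∃ c : ℤ, v = c • al θ i} := by
      refine ⟨h, v i, ?_⟩
      ext k
      by_cases hki : k = i
      · subst hki; simp [al]
      · simp [al, hki, hk k hki]
    rw [R.simple] at h1
    rcases h1 with h1 | h1
    · exact absurd h1 hv
    · rw [Set.mem_singleton_iff] at h1
      exact absurd (h1 ▸ h0) (not_neg_al_nonneg i)

lemma GRS.srefl_nonneg' {x : X} {i : Fin θ} {v : Fin θ → ℤ} (h : v ∈ R.Δ (G.ρ i x))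
    (h0 : 0 ≤ v) (hv : v ≠ al θ i) : 0 ≤ srefl G x i v :=
  R.srefl_nonneg h (R.srefl_mem_iff.2 h) h0 hv

/-- A word of length `n` inverts at most `n` positive roots. -/
lemma GRS.encard_inversions_le (i₀ : Fin θ) (w : List (Fin θ)) (x : X) :
    {v | v ∈ R.Δ (wsrc G w x) ∧ 0 ≤ v ∧ wordAct G w x v ≤ 0}.encard ≤ w.length := by
  induction w generalizing x with
  | nil =>
    have : {v | v ∈ R.Δ (wsrc G [] x) ∧ 0 ≤ v ∧ wordAct G [] x v ≤ 0} = ∅ := by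
      rw [Set.eq_empty_iff_forall_notMem]
      rintro v ⟨hv, h0, h1⟩
      exact R.ne_zero hv i₀ (le_antisymm h1 h0)
    rw [this]; simp
  | cons i l ih =>
    have hsub : {v | v ∈ R.Δ (wsrc G (i :: l) x) ∧ 0 ≤ v ∧ wordAct G (i :: l) x v ≤ 0} ⊆
        {v | v ∈ R.Δ (wsrc G l (G.ρ i x)) ∧ 0 ≤ v ∧ wordAct G l (G.ρ i x) v ≤ 0} ∪
          {v | wordAct G l (G.ρ i x) v = al θ i} := by
      rintro v ⟨hv, h0, h1⟩
      have hm := (R.wordAct_mem_iff (w := l) (x := G.ρ i x)).2 hv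
      rcases R.nonneg_or_nonpos hm with hp | hn
      · right
        by_contra hne
        have := R.srefl_nonneg' hm hp hne
        have h2 := le_antisymm h1 this
        exact R.ne_zero (R.srefl_mem_iff.2 hm) i h2
      · exact Or.inl ⟨hv, h0, hn⟩
    refine (Set.encard_le_encard hsub).trans ((Set.encard_union_le _ _).trans ?_)
    rw [List.length_cons, Nat.cast_add, Nat.cast_one]
    gcongr
    · exact ih _
    · rw [Set.encard_le_one_iff]
      exact fun a b ha hb => wordAct_injective G l _ (ha.trans hb.symm)

end Roots

end WeylGroupoid
namespace WeylGroupoid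

variable {θ : ℕ} {X : Type} [Fintype X] [DecidableEq X]

/-! ### Rank two -/

/-- The letter following `altWord i j n` in the alternating word. -/
def altLetter (i j : Fin θ) (n : ℕ) : Fin θ := if Even n then i else j

@[simp] lemma altLetter_zero (i j : Fin θ) : altLetter i j 0 = i := by simp [altLetter]

lemma altLetter_succ (i j : Fin θ) (n : ℕ) : altLetter i j (n + 1) = altLetter j i n := by
  by_cases h : Even n <;> simp [altLetter, h, Nat.even_add_one]

lemma altLetter_ne {i j : Fin θ} (h : i ≠ j) (n : ℕ) :
    altLetter i j n ≠ altLetter i j (n + 1) := by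
  by_cases hn : Even n <;> simp [altLetter, hn, Nat.even_add_one, h, h.symm]

lemma altLetter_two_mul (i j : Fin θ) (n : ℕ) :
    altLetter (altLetter i j n) (altLetter i j (n + 1)) n = i := by
  by_cases hn : Even n <;> simp [altLetter, hn, Nat.even_add_one]

lemma altLetter_cases (i j : Fin θ) (n : ℕ) :
    altLetter i j n = i ∧ altLetter i j (n + 1) = j ∨
      altLetter i j n = j ∧ altLetter i j (n + 1) = i := by
  by_cases hn : Even n <;> simp [altLetter, hn, Nat.even_add_one]

@[simp] lemma length_altWord (i j : Fin θ) (n : ℕ) : (altWord i j n).length = n := by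
  induction n generalizing i j with
  | zero => rfl
  | succ n ih => simp [altWord, ih]

lemma altWord_add (i j : Fin θ) (m n : ℕ) :
    altWord i j (m + n) =
      altWord i j m ++ altWord (altLetter i j m) (altLetter i j (m + 1)) n := by
  induction m generalizing i j with
  | zero => simp [altWord, altLetter]
  | succ m ih =>
    rw [Nat.add_right_comm, altWord, ih]
    simp only [altLetter_succ]; rfl

lemma altWord_succ (i j : Fin θ) (n : ℕ) :
    altWord i j (n + 1) = altWord i j n ++ [altLetter i j n] := altWord_add i j n 1

lemma mem_altWord {i j k : Fin θ} {n : ℕ} (h : k ∈ altWord i j n) : k = i ∨ k = j := by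
  induction n generalizing i j with
  | zero => simp [altWord] at h
  | succ n ih =>
    rcases List.mem_cons.1 h with h | h
    · exact Or.inl h
    · exact (ih h).symm

lemma pairCone_comm (i j : Fin θ) : pairCone θ i j = pairCone θ j i := by
  ext v
  constructor <;> rintro ⟨a, b, rfl⟩ <;> exact ⟨b, a, add_comm _ _⟩

lemma mem_pairCone {i j : Fin θ} (h : i ≠ j) {v : Fin θ → ℤ} :
    v ∈ pairCone θ i j ↔ 0 ≤ v ∧ ∀ k, k ≠ i → k ≠ j → v k = 0 := by
  constructor
  · rintro ⟨a, b, rfl⟩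
    refine ⟨add_nonneg (smul_nonneg (by positivity) (al_nonneg i))
      (smul_nonneg (by positivity) (al_nonneg j)), fun k hi hj => ?_⟩
    simp [al, hi, hj]
  · rintro ⟨h0, hv⟩
    refine ⟨(v i).toNat, (v j).toNat, ?_⟩
    rw [Int.toNat_of_nonneg (h0 i), Int.toNat_of_nonneg (h0 j)]
    ext k
    by_cases hi : k = i
    · subst hi; simp [al, h]
    by_cases hj : k = j
    · subst hj; simp [al, hi]
    · simp [al, hi, hj, hv k hi hj]

section RankTwo

variable {G : SCG θ X} (R : GRS G)

lemma mnum_comm (x : X) (i j : Fin θ) : mnum G R x i j = mnum G R x j i := by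
  rw [mnum, mnum, pairCone_comm]

lemma mnum_self (x : X) (i : Fin θ) : mnum G R x i i = 1 := by
  have : R.Δ x ∩ pairCone θ i i = {al θ i} := by
    ext v
    constructor
    · rintro ⟨hv, a, b, rfl⟩
      have h1 : (a : ℤ) • al θ i + (b : ℤ) • al θ i ∈
          R.Δ x ∩ {v | ∃ c : ℤ, v = c • al θ i} := ⟨hv, a + b, by rw [add_smul]⟩
      rw [R.simple] at h1
      refine h1.resolve_right fun h2 => not_neg_al_nonneg i ?_
      rw [Set.mem_singleton_iff] at h2
      rw [← h2]
      exact add_nonneg (smul_nonneg (by positivity) (al_nonneg i))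
        (smul_nonneg (by positivity) (al_nonneg i))
    · rintro rfl
      exact ⟨R.al_mem x i, 1, 0, by simp⟩
  rw [mnum, this, Set.ncard_singleton]

lemma mnum_le_mnum_rho (x : X) {i j : Fin θ} (h : i ≠ j) :
    mnum G R x i j ≤ mnum G R (G.ρ i x) i j := by
  classical
  refine Set.ncard_le_ncard_of_injOn
    (fun v => if v = al θ i then al θ i else srefl G x i v) ?_ ?_ (R.pairFinite _ i j)
  · rintro v ⟨hv, hc⟩
    by_cases hi : v = al θ i
    · simp only [hi, if_true]
      exact ⟨R.al_mem _ i, 1, 0, by simp⟩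
    · simp only [hi, if_false]
      refine ⟨R.srefl_mem i hv, ?_⟩
      rw [mem_pairCone h] at hc ⊢
      have h1 := R.srefl_nonneg (y := G.ρ i x) hv (by simpa using R.srefl_mem i hv) hc.1 hi
      rw [srefl_rho] at h1
      exact ⟨h1, fun k hi hj => by rw [srefl_apply_of_ne G x hi, hc.2 k hi hj]⟩
  · rintro u ⟨hu, hcu⟩ v ⟨hv, hcv⟩ huv
    rw [mem_pairCone h] at hcu hcv
    have aux : ∀ v : Fin θ → ℤ, 0 ≤ v → al θ i ≠ srefl G x i v := fun v hv he => by
      have h2 := congrArg (srefl G x i) he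
      rw [srefl_srefl, srefl_al] at h2
      exact not_neg_al_nonneg i (h2 ▸ hv)
    by_cases hui : u = al θ i <;> by_cases hvi : v = al θ i
    · rw [hui, hvi]
    · simp only [hui, hvi, if_true, if_false] at huv
      exact absurd huv (aux v hcv.1)
    · simp only [hui, hvi, if_true, if_false] at huv
      exact absurd huv.symm (aux u hcu.1)
    · simp only [hui, hvi, if_false] at huv
      exact srefl_injective G x i huv

lemma mnum_rho (x : X) {i j : Fin θ} (h : i ≠ j) :
    mnum G R (G.ρ i x) i j = mnum G R x i j := by
  refine le_antisymm ?_ (mnum_le_mnum_rho R x h)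
  simpa [G.invol] using mnum_le_mnum_rho R (G.ρ i x) h

lemma mnum_wsrc_altWord (x : X) {i j : Fin θ} (h : i ≠ j) (n : ℕ) :
    mnum G R (wsrc G (altWord i j n) x) i j = mnum G R x i j := by
  induction n generalizing i j x with
  | zero => rfl
  | succ n ih => rw [altWord, wsrc, mnum_comm, ih _ h.symm, mnum_comm, mnum_rho R _ h]

lemma two_le_mnum (x : X) {i j : Fin θ} (h : i ≠ j) : 2 ≤ mnum G R x i j := by
  have hne : al θ i ≠ al θ j := fun he => by
    have := congrFun he i
    simp [al, h] at this
  rw [← Set.ncard_pair hne]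
  refine Set.ncard_le_ncard ?_ (R.pairFinite x i j)
  rintro v (rfl | rfl)
  · exact ⟨R.al_mem x _, 1, 0, by simp⟩
  · exact ⟨R.al_mem x _, 0, 1, by simp⟩

/-- The root `s_i s_j s_i ⋯ (α)`, with `n` reflections. -/
def altRoot (G : SCG θ X) (x : X) (i j : Fin θ) (n : ℕ) : Fin θ → ℤ :=
  wordAct G (altWord i j n) x (al θ (altLetter i j n))

lemma altRoot_zero (x : X) (i j : Fin θ) : altRoot G x i j 0 = al θ i := by
  simp [altRoot, altWord]

lemma altRoot_succ (x : X) (i j : Fin θ) (n : ℕ) :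
    altRoot G x i j (n + 1) = srefl G x i (altRoot G (G.ρ i x) j i n) := by
  rw [altRoot, altWord, wordAct_cons, altLetter_succ]; rfl

lemma wordAct_altWord_succ (x : X) (i j : Fin θ) (n : ℕ) :
    wordAct G (altWord i j (n + 1)) x (al θ (altLetter i j n)) = -altRoot G x i j n := by
  rw [altWord_succ, wordAct_append]
  simp [altRoot]

lemma altRoot_mem (x : X) (i j : Fin θ) (n : ℕ) : altRoot G x i j n ∈ R.Δ x :=
  R.wordAct_mem_iff.2 (R.al_mem _ _)

lemma altRoot_apply (x : X) {i j k : Fin θ} (n : ℕ) (hi : k ≠ i) (hj : k ≠ j) :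
    altRoot G x i j n k = 0 := by
  rw [altRoot, wordAct_apply_of_notMem]
  · rcases altLetter_cases i j n with h | h <;> rw [h.1] <;> simp [al, hi, hj]
  · intro h
    rcases mem_altWord h with h | h
    · exact hi h
    · exact hj h

/-- The first `m_{ij}` roots of the alternating sequence are positive. -/
lemma altRoot_nonneg (x : X) {i j : Fin θ} (h : i ≠ j) {n : ℕ} (hn : n < mnum G R x i j) :
    0 ≤ altRoot G x i j n := by
  induction n generalizing x i j with
  | zero => rw [altRoot_zero]; exact al_nonneg i
  | succ n ih =>
    have hm : n < mnum G R (G.ρ i x) j i := by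
      rw [mnum_comm, mnum_rho R x h]; omega
    have hmem := altRoot_mem R (G.ρ i x) j i n
    rw [altRoot_succ]
    refine R.srefl_nonneg' hmem (ih _ h.symm hm) fun heq => ?_
    have hneg1 : wordAct G (altWord i j (n + 1)) x (al θ (altLetter i j n)) ≤ 0 := by
      rw [wordAct_altWord_succ]
      exact neg_nonpos.2 (ih x h (by omega))
    have hneg2 : wordAct G (altWord i j (n + 1)) x (al θ (altLetter i j (n + 1))) ≤ 0 := by
      have : altRoot G x i j (n + 1) = -al θ i := by rw [altRoot_succ, heq, srefl_al]
      rw [← altRoot, this]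
      exact neg_nonpos.2 (al_nonneg i)
    have hall : ∀ k, k = i ∨ k = j → wordAct G (altWord i j (n + 1)) x (al θ k) ≤ 0 := by
      rcases altLetter_cases i j n with ⟨h1, h2⟩ | ⟨h1, h2⟩ <;> rw [h1] at hneg1 <;>
        rw [h2] at hneg2 <;> rintro k (rfl | rfl) <;> assumption
    have hle := R.encard_inversions_le i (altWord i j (n + 1)) x
    have hsub : R.Δ (wsrc G (altWord i j (n + 1)) x) ∩ pairCone θ i j ⊆
        {v | v ∈ R.Δ (wsrc G (altWord i j (n + 1)) x) ∧ 0 ≤ v ∧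
          wordAct G (altWord i j (n + 1)) x v ≤ 0} := by
      rintro v ⟨hv, hc⟩
      refine ⟨hv, ((mem_pairCone h).1 hc).1, ?_⟩
      obtain ⟨a, b, rfl⟩ := hc
      rw [map_add, map_smul, map_smul]
      exact add_nonpos (smul_nonpos_of_nonneg_of_nonpos (by positivity) (hall i (Or.inl rfl)))
        (smul_nonpos_of_nonneg_of_nonpos (by positivity) (hall j (Or.inr rfl)))
    have h2 := (Set.encard_le_encard hsub).trans hle
    rw [← (R.pairFinite _ i j).cast_ncard_eq, length_altWord, Nat.cast_le] at h2
    have h3 : mnum G R (wsrc G (altWord i j (n + 1)) x) i j ≤ n + 1 := h2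
    rw [mnum_wsrc_altWord R x h] at h3
    omega

lemma altRoot_ne_al (x : X) {i j : Fin θ} (h : i ≠ j) {n : ℕ} (hn : n + 1 < mnum G R x i j) :
    altRoot G x i j (n + 1) ≠ al θ i := by
  intro he
  rw [altRoot_succ] at he
  have h2 := congrArg (srefl G x i) he
  rw [srefl_srefl, srefl_al] at h2
  refine not_neg_al_nonneg i (h2 ▸ altRoot_nonneg R (G.ρ i x) h.symm ?_)
  rw [mnum_comm, mnum_rho R x h]; omega

lemma altRoot_ne (x : X) {i j : Fin θ} (h : i ≠ j) {k l : ℕ} (hkl : k < l)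
    (hl : l < mnum G R x i j) : altRoot G x i j k ≠ altRoot G x i j l := by
  induction k generalizing l x i j with
  | zero =>
    obtain ⟨l, rfl⟩ := Nat.exists_eq_succ_of_ne_zero hkl.ne'
    rw [altRoot_zero]
    exact (altRoot_ne_al R x h hl).symm
  | succ k ih =>
    obtain ⟨l, rfl⟩ := Nat.exists_eq_succ_of_ne_zero (Nat.ne_zero_of_lt hkl)
    rw [Nat.succ_eq_add_one, altRoot_succ, altRoot_succ]
    refine fun he => ih (G.ρ i x) h.symm (l := l) (by omega) ?_ (srefl_injective G x i he)
    rw [mnum_comm, mnum_rho R x h]; omega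

/-- The alternating sequence of positive roots starting with `α_i` ends with `α_j`. -/
lemma altRoot_last (x : X) {i j : Fin θ} (h : i ≠ j) {n : ℕ} (hn : mnum G R x i j = n + 1) :
    altRoot G x i j n = al θ j := by
  have himg : (fun k => altRoot G x i j k) '' (Set.Iio (n + 1)) = R.Δ x ∩ pairCone θ i j := by
    refine Set.eq_of_subset_of_ncard_le ?_ ?_ (R.pairFinite x i j)
    · rintro _ ⟨k, hk, rfl⟩
      exact ⟨altRoot_mem R x i j k, (mem_pairCone h).2
        ⟨altRoot_nonneg R x h (hn ▸ hk), fun l => altRoot_apply x k⟩⟩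
    · rw [Set.InjOn.ncard_image]
      · change mnum G R x i j ≤ _
        rw [hn]
        simp [Set.ncard_eq_toFinset_card']
      · intro k hk l hl he
        simp only [Set.mem_Iio] at hk hl
        rcases lt_trichotomy k l with hlt | heq | hlt
        · exact absurd he (altRoot_ne R x h hlt (hn ▸ hl))
        · exact heq
        · exact absurd he.symm (altRoot_ne R x h hlt (hn ▸ hk))
  have hj : al θ j ∈ R.Δ x ∩ pairCone θ i j := ⟨R.al_mem x j, 0, 1, by simp⟩
  rw [← himg] at hj
  obtain ⟨k, hk, hkj⟩ := hj
  simp only [Set.mem_Iio] at hk hkj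
  rcases (Nat.lt_succ_iff.1 hk).lt_or_eq with hlt | rfl
  · exfalso
    have h1 : altRoot G (G.ρ j x) j i (k + 1) = -al θ j := by
      rw [altRoot_succ, G.invol, hkj, srefl_rho, srefl_al]
    refine not_neg_al_nonneg j (h1 ▸ altRoot_nonneg R (G.ρ j x) h.symm ?_)
    rw [mnum_rho R x h.symm, mnum_comm]; omega
  · exact hkj

lemma wordAct_altWord_mnum (x : X) {i j : Fin θ} (h : i ≠ j) :
    wordAct G (altWord i j (mnum G R x i j)) x (al θ (altLetter i j (mnum G R x i j))) =
        -al θ i ∧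
      wordAct G (altWord i j (mnum G R x i j)) x (al θ (altLetter i j (mnum G R x i j + 1))) =
        -al θ j := by
  obtain ⟨n, hn⟩ := Nat.exists_eq_succ_of_ne_zero (n := mnum G R x i j)
    (by have := two_le_mnum R x h; omega)
  have h1 := altRoot_last R x h hn
  have h2 := altRoot_last R (G.ρ i x) h.symm
    (show mnum G R (G.ρ i x) j i = n + 1 by rw [mnum_comm, mnum_rho R x h, hn])
  rw [hn]
  constructor
  · change altRoot G x i j (n + 1) = _
    rw [altRoot_succ, h2, srefl_al]
  · rw [altLetter_succ, Nat.succ_eq_add_one, altLetter_succ, wordAct_altWord_succ, h1]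

lemma wsrc_altWord_two_mul (x : X) (i j : Fin θ) (n : ℕ) :
    wsrc G (altWord i j (2 * n)) x = (fun y => G.ρ j (G.ρ i y))^[n] x := by
  induction n generalizing x with
  | zero => rfl
  | succ n ih =>
    rw [Function.iterate_succ_apply, ← ih]
    rfl

lemma wsrc_altWord_mnum (x : X) (i j : Fin θ) :
    wsrc G (altWord i j (2 * mnum G R x i j)) x = x := by
  rw [wsrc_altWord_two_mul, mnum_comm]
  exact R.loop x j i

/-- The defining relations of the Weyl groupoid hold for the linear action. -/
lemma wordAct_altWord_two_mul (x : X) (i j : Fin θ) :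
    wordAct G (altWord i j (2 * mnum G R x i j)) x = 1 := by
  rcases eq_or_ne i j with rfl | h
  · rw [mnum_self]
    refine LinearMap.ext fun v => ?_
    simp [altWord]
  set m := mnum G R x i j with hm
  have hi : wordAct G (altWord i j (2 * m)) x (al θ i) = al θ i ∧
      wordAct G (altWord i j (2 * m)) x (al θ j) = al θ j := by
    have h1 := wordAct_altWord_mnum R x h
    have h2 := wordAct_altWord_mnum R (wsrc G (altWord i j m) x) (altLetter_ne h m)
    have h3 : mnum G R (wsrc G (altWord i j m) x) (altLetter i j m) (altLetter i j (m + 1)) =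
        m := by
      rcases altLetter_cases i j m with ⟨e1, e2⟩ | ⟨e1, e2⟩ <;> rw [e1, e2]
      · exact mnum_wsrc_altWord R x h m
      · rw [mnum_comm]; exact mnum_wsrc_altWord R x h m
    have h4 : altLetter (altLetter i j m) (altLetter i j (m + 1)) (m + 1) = j := by
      rw [altLetter_succ, altLetter_succ]
      have := altLetter_two_mul j i m
      rwa [altLetter_succ, ← altLetter_succ i j, altLetter_succ] at this
    rw [h3, altLetter_two_mul, h4] at h2
    rw [two_mul, altWord_add, wordAct_append, wordAct_append, h2.1, h2.2, map_neg, map_neg,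
      hm, h1.1, h1.2, neg_neg, neg_neg]
    exact ⟨rfl, rfl⟩
  set A := wordAct G (altWord i j (2 * m)) x with hA
  have hsrc : wsrc G (altWord i j (2 * m)) x = x := wsrc_altWord_mnum R x i j
  have hbasis : ∀ k, A (al θ k) = al θ k := by
    intro k
    by_cases hki : k = i
    · rw [hki, hi.1]
    by_cases hkj : k = j
    · rw [hkj, hi.2]
    have hl : ∀ l, l ≠ i → l ≠ j → A (al θ k) l = al θ k l := fun l hli hlj =>
      wordAct_apply_of_notMem G (fun hl => (mem_altWord hl).elim hli hlj) x _
    have hAk : A (al θ k) = al θ k + (A (al θ k) i • al θ i + A (al θ k) j • al θ j) := by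
      ext l
      by_cases hli : l = i
      · subst hli; simp [al, Ne.symm hki, h]
      by_cases hlj : l = j
      · subst hlj; simp [al, Ne.symm hkj, hli]
      · rw [hl l hli hlj]; simp [al, hli, hlj]
    set a := A (al θ k) i with ha
    set b := A (al θ k) j with hb
    have hpos : 0 ≤ A (al θ k) := by
      refine (R.nonneg_or_nonpos (x := x)
        (R.wordAct_mem_iff.2 (R.al_mem _ k))).resolve_right fun hn => ?_
      have := hn k
      rw [hl k hki hkj] at this
      simp [al] at this
    have hinv : A (al θ k - (a • al θ i + b • al θ j)) = al θ k := by
      rw [map_sub, map_add, map_smul, map_smul, hi.1, hi.2, sub_eq_iff_eq_add]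
      exact hAk
    have hmem : al θ k - (a • al θ i + b • al θ j) ∈ R.Δ x := by
      rw [← hsrc, ← R.wordAct_mem_iff (w := altWord i j (2 * m)) (x := x), ← hA, hinv]
      exact R.al_mem x k
    have hpos' : 0 ≤ al θ k - (a • al θ i + b • al θ j) := by
      refine (R.nonneg_or_nonpos hmem).resolve_right fun hn => ?_
      have := hn k
      simp [al, hki, hkj] at this
    have ha0 : a = 0 := by
      refine le_antisymm ?_ (hpos i)
      have := hpos' i
      simp [al, Ne.symm hki, h] at this
      exact this
    have hb0 : b = 0 := by
      refine le_antisymm ?_ (hpos j)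
      have := hpos' j
      simp [al, Ne.symm hkj, h.symm] at this
      exact this
    rw [hAk, ha0, hb0]; simp
  refine LinearMap.pi_ext' fun k => LinearMap.ext_ring ?_
  simpa [al] using hbasis k

end RankTwo

end WeylGroupoid
namespace WeylGroupoid

variable {θ : ℕ} {X : Type} [Fintype X] [DecidableEq X]

/-! ### Words in the Weyl groupoid -/

section Words

variable {G : SCG θ X} (R : GRS G)

/-- The morphism defined by a word, bundled with its source. -/
def wordMor (w : List (Fin θ)) (x : X) : Σ y, homW G R y x := ⟨wsrc G w x, morW G R w x⟩

lemma castW_eq_iff {a b c : X} (h : a = b) (f : homW G R a c) (g : homW G R b c) :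
    castW G R h f = g ↔ (⟨a, f⟩ : Σ y, homW G R y c) = ⟨b, g⟩ := by
  subst h
  simp [castW]

lemma exists_castW_eq_iff {w : List (Fin θ)} {x y : X} {f : homW G R y x} :
    (∃ h : wsrc G w x = y, castW G R h (morW G R w x) = f) ↔ wordMor R w x = ⟨y, f⟩ := by
  constructor
  · rintro ⟨h, e⟩
    exact (castW_eq_iff R h _ _).1 e
  · intro e
    have h : wsrc G w x = y := congrArg Sigma.fst e
    exact ⟨h, (castW_eq_iff R h _ _).2 e⟩

lemma morW_cons (i : Fin θ) (l : List (Fin θ)) (x : X) :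
    morW G R (i :: l) x =
      CategoryStruct.comp (obj := W G R) (morW G R l (G.ρ i x)) (genW G R x i) :=
  (Quotient.functor (wrel G R)).map_comp _ _

lemma wordMor_append (p q : List (Fin θ)) (x : X) :
    wordMor R (p ++ q) x = ⟨(wordMor R q (wordMor R p x).1).1,
      CategoryStruct.comp (obj := W G R) (wordMor R q (wordMor R p x).1).2
        (wordMor R p x).2⟩ := by
  induction p generalizing x with
  | nil =>
    have h : morW G R [] x = 𝟙 (objW G R x) := (Quotient.functor (wrel G R)).map_id _
    change (⟨_, morW G R q x⟩ : Σ y, homW G R y x) =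
      ⟨_, CategoryStruct.comp (obj := W G R) (morW G R q x) (morW G R [] x)⟩
    rw [h]
    exact congrArg _ (Category.comp_id (obj := W G R) _).symm
  | cons i l ih =>
    have h1 : wordMor R (i :: l ++ q) x = ⟨(wordMor R (l ++ q) (G.ρ i x)).1,
        CategoryStruct.comp (obj := W G R) (wordMor R (l ++ q) (G.ρ i x)).2 (genW G R x i)⟩ :=
      congrArg (Sigma.mk _) (morW_cons R i (l ++ q) x)
    have h2 : (wordMor R (i :: l) x).2 =
        CategoryStruct.comp (obj := W G R) (wordMor R l (G.ρ i x)).2 (genW G R x i) :=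
      morW_cons R i l x
    rw [h1, ih, h2]
    exact congrArg (Sigma.mk _) (Category.assoc (obj := W G R) _ _ _)

lemma wordMor_append_congr_left {p p' : List (Fin θ)} {x : X} (h : wordMor R p x = wordMor R p' x)
    (q : List (Fin θ)) : wordMor R (p ++ q) x = wordMor R (p' ++ q) x := by
  rw [wordMor_append, wordMor_append, h]

lemma wordMor_append_congr_right {q q' : List (Fin θ)} {x : X} (p : List (Fin θ))
    (h : wordMor R q (wsrc G p x) = wordMor R q' (wsrc G p x)) :
    wordMor R (p ++ q) x = wordMor R (p ++ q') x := by
  rw [wordMor_append, wordMor_append]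
  exact congrArg (fun s : Σ y, homW G R y (wsrc G p x) => (⟨s.1,
    CategoryStruct.comp (obj := W G R) s.2 (wordMor R p x).2⟩ : Σ y, homW G R y x)) h

lemma wordMor_relation (x : X) (i j : Fin θ) :
    wordMor R (altWord i j (2 * mnum G R x i j)) x = wordMor R [] x := by
  have h := wsrc_altWord_mnum R x i j
  have h1 := CategoryTheory.Quotient.sound (wrel G R) (wrel.rel (R := R) x i j h)
  refine (exists_castW_eq_iff R (f := morW G R [] x)).1 ⟨h, ?_⟩
  refine Eq.trans ?_ h1
  have : ∀ {a b : X} (h : a = b) (f : pob G a ⟶ pob G x),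
      castW G R h ((Quotient.functor (wrel G R)).map f) =
        (Quotient.functor (wrel G R)).map (castSrc G h f) := by
    rintro a b rfl f; rfl
  exact this h _

lemma wordMor_pair (x : X) (i : Fin θ) : wordMor R [i, i] x = wordMor R [] x := by
  simpa [mnum_self, altWord] using wordMor_relation R x i i

lemma wordMor_append_reverse (w : List (Fin θ)) (x : X) :
    wordMor R (w ++ w.reverse) x = wordMor R [] x := by
  induction w generalizing x with
  | nil => rfl
  | cons i l ih =>
    have h1 : wordMor R ([i] ++ ((l ++ l.reverse) ++ [i])) x = wordMor R ([i] ++ [i]) x :=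
      wordMor_append_congr_right R [i] (wordMor_append_congr_left R (ih _) [i])
    simpa using h1.trans (wordMor_pair R x i)

/-- The functor recording the linear action and the sign of a path. -/
def actFunctor (G : SCG θ X) :
    Paths (Obj G) ⥤ SingleObj (Module.End ℤ (Fin θ → ℤ) × ℤˣ) :=
  Paths.lift
    { obj := fun _ => SingleObj.star _
      map := fun {_ b} i => (reflLin G (show X from b) i.1, -1) }

lemma actFunctor_pathOf (w : List (Fin θ)) (x : X) :
    (actFunctor G).map (pathOf G w x) = (wordAct G w x, (-1) ^ w.length) := by
  induction w generalizing x with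
  | nil => exact (actFunctor G).map_id _
  | cons i l ih =>
    refine ((actFunctor G).map_comp (pathOf G l (G.ρ i x)) (genArrow G x i)).trans ?_
    rw [ih]
    have h : (actFunctor G).map (genArrow G x i) = (reflLin G x i, -1) := by
      exact Category.id_comp (obj := SingleObj (Module.End ℤ (Fin θ → ℤ) × ℤˣ))
        (X := SingleObj.star _) (Y := SingleObj.star _) _
    rw [h]
    refine Prod.ext rfl ?_
    change (-1) * (-1 : ℤˣ) ^ l.length = _
    rw [List.length_cons, pow_succ, mul_comm]

/-- The linear action and the sign, on the Weyl groupoid. -/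
def actFunctorW : CategoryTheory.Quotient (wrel G R) ⥤
    SingleObj (Module.End ℤ (Fin θ → ℤ) × ℤˣ) :=
  CategoryTheory.Quotient.lift (wrel G R) (actFunctor G) (by
    intro a b f g hfg
    induction hfg with
    | rel x i j h =>
      have hc : ∀ {a b c : X} (h : a = b) (f : pob G a ⟶ pob G c),
          ((actFunctor G).map (castSrc G h f) : Module.End ℤ (Fin θ → ℤ) × ℤˣ) =
            (actFunctor G).map f := by
        rintro a b c rfl f; rfl
      refine (hc h _).trans ((actFunctor_pathOf _ _).trans ?_)
      rw [wordAct_altWord_two_mul, length_altWord, pow_mul]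
      refine Eq.trans ?_ ((actFunctor G).map_id _).symm
      simp; rfl)

lemma act_eq_of_wordMor_eq {w w' : List (Fin θ)} {x : X} (h : wordMor R w x = wordMor R w' x) :
    wordAct G w x = wordAct G w' x ∧ (-1 : ℤˣ) ^ w.length = (-1) ^ w'.length := by
  have key : ∀ w : List (Fin θ),
      ((actFunctorW R).map (wordMor R w x).2 : Module.End ℤ (Fin θ → ℤ) × ℤˣ) =
        (wordAct G w x, (-1) ^ w.length) := fun w => actFunctor_pathOf w x
  have h2 : (wordAct G w x, (-1 : ℤˣ) ^ w.length) = (wordAct G w' x, (-1 : ℤˣ) ^ w'.length) := by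
    rw [← key, ← key, h]
  exact Prod.mk.inj h2

lemma even_length_iff_of_wordMor_eq {w w' : List (Fin θ)} {x : X}
    (h : wordMor R w x = wordMor R w' x) : Even w.length ↔ Even w'.length := by
  have h1 := (act_eq_of_wordMor_eq R h).2
  by_cases h2 : Even w.length <;> by_cases h3 : Even w'.length
  · simp [h2, h3]
  · rw [h2.neg_one_pow, (Nat.not_even_iff_odd.1 h3).neg_one_pow] at h1
    exact absurd h1 (by decide)
  · rw [h3.neg_one_pow, (Nat.not_even_iff_odd.1 h2).neg_one_pow] at h1
    exact absurd h1 (by decide)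
  · simp [h2, h3]

/-! ### Reduced words -/

/-- A word is reduced if no shorter word defines the same morphism. -/
def IsReducedWord (w : List (Fin θ)) (x : X) : Prop :=
  ∀ w', wordMor R w' x = wordMor R w x → w.length ≤ w'.length

lemma len_eq_sInf {x y : X} (f : homW G R y x) :
    len G R f = sInf {n | ∃ w : List (Fin θ), w.length = n ∧ wordMor R w x = ⟨y, f⟩} := by
  simp only [len, exists_castW_eq_iff]

lemma exists_isReducedWord (w : List (Fin θ)) (x : X) :
    ∃ w', wordMor R w' x = wordMor R w x ∧ IsReducedWord R w' x := by
  have hne : {n | ∃ w' : List (Fin θ), w'.length = n ∧ wordMor R w' x = wordMor R w x}.Nonempty :=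
    ⟨_, w, rfl, rfl⟩
  obtain ⟨w', hw', he⟩ := Nat.sInf_mem hne
  exact ⟨w', he, fun v hv => hw' ▸ Nat.sInf_le ⟨v, rfl, hv.trans he⟩⟩

lemma isReducedWord_iff {w : List (Fin θ)} {x y : X} {f : homW G R y x}
    (h : wordMor R w x = ⟨y, f⟩) : IsReducedWord R w x ↔ w.length = len G R f := by
  have hne : {n | ∃ w : List (Fin θ), w.length = n ∧ wordMor R w x = ⟨y, f⟩}.Nonempty :=
    ⟨_, w, rfl, h⟩
  constructor
  · intro hr
    rw [len_eq_sInf]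
    refine le_antisymm (le_csInf hne ?_) (Nat.sInf_le ⟨w, rfl, h⟩)
    rintro _ ⟨v, rfl, hv⟩
    exact hr v (hv.trans h.symm)
  · intro hl v hv
    rw [hl, len_eq_sInf]
    exact Nat.sInf_le ⟨v, rfl, hv.trans h⟩

variable {R}

lemma IsReducedWord.of_append_left {p q : List (Fin θ)} {x : X}
    (h : IsReducedWord R (p ++ q) x) : IsReducedWord R p x := fun p' hp => by
  simpa using h (p' ++ q) (wordMor_append_congr_left R hp q)

lemma IsReducedWord.of_append_right {p q : List (Fin θ)} {x : X}
    (h : IsReducedWord R (p ++ q) x) : IsReducedWord R q (wsrc G p x) := fun q' hq => by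
  simpa using h (p ++ q') (wordMor_append_congr_right R p hq)

lemma IsReducedWord.congr {w w' : List (Fin θ)} {x : X} (h : IsReducedWord R w x)
    (he : wordMor R w' x = wordMor R w x) (hl : w'.length ≤ w.length) : IsReducedWord R w' x :=
  fun v hv => hl.trans (h v (hv.trans he))

lemma isReducedWord_nil (x : X) : IsReducedWord R [] x := fun _ _ => Nat.zero_le _

lemma not_isReducedWord_pair (i : Fin θ) (x : X) : ¬ IsReducedWord R [i, i] x := fun h => by
  simpa using h [] (wordMor_pair R x i).symm

/-- If a word stops being reduced after adding a letter at the end, it is equivalent to a word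
of the same length ending with this letter. -/
lemma exists_of_not_isReducedWord_concat {w : List (Fin θ)} {x : X} {i : Fin θ}
    (hn : ¬ IsReducedWord R (w ++ [i]) x) :
    ∃ v : List (Fin θ), v.length < w.length ∧ wordMor R (v ++ [i]) x = wordMor R w x := by
  obtain ⟨v, hv, hr⟩ := exists_isReducedWord R (w ++ [i]) x
  have hle := hr _ hv.symm
  have hne : v.length ≠ (w ++ [i]).length := fun he => hn (hr.congr hv.symm he.ge)
  have hev := even_length_iff_of_wordMor_eq R hv
  rw [List.length_append, List.length_singleton] at hle hne hev
  refine ⟨v, ?_, ?_⟩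
  · have : v.length ≠ w.length := fun he => iff_not_self (by rwa [he, Nat.even_add_one] at hev)
    omega
  · rw [wordMor_append_congr_left R hv, List.append_assoc]
    have := wordMor_append_congr_right R w (wordMor_pair R (wsrc G w x) i)
    simpa using this

/-- If a word stops being reduced after adding a letter at the front, it is equivalent to a
word of the same length starting with this letter. -/
lemma exists_of_not_isReducedWord_cons {w : List (Fin θ)} {x : X} {i : Fin θ}
    (hn : ¬ IsReducedWord R (i :: w) x) :
    ∃ v : List (Fin θ), v.length < w.length ∧
      wordMor R (i :: v) (G.ρ i x) = wordMor R w (G.ρ i x) := by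
  obtain ⟨v, hv, hr⟩ := exists_isReducedWord R (i :: w) x
  have hle := hr _ hv.symm
  have hne : v.length ≠ (i :: w).length := fun he => hn (hr.congr hv.symm he.ge)
  have hev := even_length_iff_of_wordMor_eq R hv
  rw [List.length_cons] at hle hne hev
  refine ⟨v, ?_, ?_⟩
  · have : v.length ≠ w.length := fun he => iff_not_self (by rwa [he, Nat.even_add_one] at hev)
    omega
  · have h1 : wordMor R ([i] ++ v) (G.ρ i x) = wordMor R ([i] ++ (i :: w)) (G.ρ i x) := by
      refine wordMor_append_congr_right R [i] ?_
      change wordMor R v (G.ρ i (G.ρ i x)) = wordMor R (i :: w) (G.ρ i (G.ρ i x))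
      rw [G.invol, hv]
    have h2 := wordMor_append_congr_left R (wordMor_pair R (G.ρ i x) i) w
    exact h1.trans h2

lemma not_isReducedWord_altWord {x : X} {i j : Fin θ} (h : i ≠ j) {n : ℕ}
    (hn : mnum G R x i j < n) : ¬ IsReducedWord R (altWord i j n) x := by
  set m := mnum G R x i j with hm
  intro hr
  have hm2 := two_le_mnum R x h
  have hr' : IsReducedWord R (altWord i j (m + 1)) x := by
    have h1 := altWord_add i j (m + 1) (n - (m + 1))
    rw [Nat.add_sub_of_le hn] at h1
    rw [h1] at hr
    exact hr.of_append_left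
  have h1 := altWord_add i j (m + 1) (m - 1)
  rw [show m + 1 + (m - 1) = 2 * m by omega] at h1
  set u := altWord i j (m + 1)
  set r := altWord (altLetter i j (m + 1)) (altLetter i j (m + 1 + 1)) (m - 1) with hrdef
  have h2 : wordMor R (u ++ (r ++ r.reverse)) x = wordMor R (u ++ []) x :=
    wordMor_append_congr_right R u (wordMor_append_reverse R r _)
  have h3 : wordMor R (u ++ r) x = wordMor R [] x := h1 ▸ wordMor_relation R x i j
  have h4 := wordMor_append_congr_left R h3 r.reverse
  rw [List.append_assoc, h2] at h4
  have h5 := hr' r.reverse (by simpa using h4.symm)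
  simp [u, hrdef] at h5
  omega

lemma eq_altWord_of_isReducedWord {i j : Fin θ} {w : List (Fin θ)} {x : X}
    (hw : ∀ k ∈ w, k = i ∨ k = j) (hr : IsReducedWord R w x) :
    w = altWord i j w.length ∨ w = altWord j i w.length := by
  induction w generalizing x with
  | nil => exact Or.inl rfl
  | cons c l ih =>
    have hl := ih (fun k hk => hw k (List.mem_cons_of_mem _ hk))
      (IsReducedWord.of_append_right (p := [c]) hr)
    have aux : ∀ a b : Fin θ, (c = a ∨ c = b) → l = altWord a b l.length →
        c :: l = altWord a b (c :: l).length ∨ c :: l = altWord b a (c :: l).length := by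
      intro a b hc hl
      rcases hc with rfl | rfl
      · rcases l with _ | ⟨d, l⟩
        · exact Or.inl rfl
        · exfalso
          have hd : d = c := (List.cons.inj hl).1
          subst hd
          exact not_isReducedWord_pair d x (IsReducedWord.of_append_left (q := l) hr)
      · right
        rw [List.length_cons, altWord, ← hl]
    have hc := hw c List.mem_cons_self
    rcases hl with hl | hl
    · exact aux i j hc hl
    · exact (aux j i hc.symm hl).symm

/-- If `w σ_i` is reduced, then `w` maps `α_i` to a positive root. -/
theorem IsReducedWord.wordAct_al_nonneg {w : List (Fin θ)} {x : X} {i : Fin θ}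
    (h : IsReducedWord R (w ++ [i]) x) : 0 ≤ wordAct G w x (al θ i) := by
  induction hn : w.length using Nat.strong_induction_on generalizing w i with
  | _ n ih =>
  subst hn
  rcases List.eq_nil_or_concat' w with rfl | ⟨w', j, hwdef⟩
  · exact al_nonneg i
  have hij : i ≠ j := by
    rintro rfl
    rw [hwdef, List.append_assoc] at h
    exact not_isReducedWord_pair i _ h.of_append_right
  have hw : IsReducedWord R w x := h.of_append_left
  classical
  have hex : ∃ k, ∃ p q : List (Fin θ), p.length = k ∧ (∀ c ∈ q, c = i ∨ c = j) ∧
      p.length + q.length = w.length ∧ wordMor R (p ++ q) x = wordMor R w x :=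
    ⟨_, w', [j], rfl, by simp, by simp [hwdef], by rw [hwdef]⟩
  obtain ⟨p, q, hpk, hq, hlen, hpq⟩ := Nat.find_spec hex
  have hplt : p.length < w.length := by
    rw [hpk]
    refine lt_of_le_of_lt (Nat.find_min' hex
      ⟨w', [j], rfl, by simp, by simp [hwdef], by rw [hwdef]⟩) ?_
    simp [hwdef]
  have hpos : ∀ c, c = i ∨ c = j → 0 ≤ wordAct G p x (al θ c) := by
    intro c hc
    refine ih _ hplt ?_ rfl
    by_contra hnr
    obtain ⟨v, hv, hve⟩ := exists_of_not_isReducedWord_concat hnr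
    have he : wordMor R (v ++ c :: q) x = wordMor R w x := by
      rw [← hpq, ← wordMor_append_congr_left R hve q]; simp
    have hle := hw _ he
    rw [List.length_append, List.length_cons] at hle
    refine Nat.find_min hex (m := v.length) (hpk ▸ hv)
      ⟨v, c :: q, rfl, ?_, by simp only [List.length_cons]; omega, he⟩
    rintro d hd
    rcases List.mem_cons.1 hd with rfl | hd
    · exact hc
    · exact hq d hd
  have hqi : IsReducedWord R (q ++ [i]) (wsrc G p x) := by
    refine IsReducedWord.of_append_right (p := p) (h.congr ?_ ?_)
    · rw [← List.append_assoc]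
      exact wordMor_append_congr_left R hpq [i]
    · simp; omega
  have hcone : 0 ≤ wordAct G q (wsrc G p x) (al θ i) := by
    have aux : ∀ a b : Fin θ, a ≠ b → q ++ [i] = altWord a b (q ++ [i]).length →
        0 ≤ wordAct G q (wsrc G p x) (al θ i) := by
      intro a b hab he
      have hle : (q ++ [i]).length ≤ mnum G R (wsrc G p x) a b := by
        by_contra hlt
        exact not_isReducedWord_altWord hab (not_le.1 hlt) (he ▸ hqi)
      rw [List.length_append, List.length_singleton] at he hle
      rw [altWord_succ] at he
      obtain ⟨h1, h2⟩ := List.append_inj' he rfl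
      rw [(List.cons.inj h2).1]
      nth_rewrite 1 [h1]
      exact altRoot_nonneg R (wsrc G p x) hab hle
    have hletters : ∀ k ∈ q ++ [i], k = i ∨ k = j := fun k hk =>
      (List.mem_append.1 hk).elim (hq k) fun hk => Or.inl (List.mem_singleton.1 hk)
    rcases eq_altWord_of_isReducedWord (i := i) (j := j) hletters hqi with he | he
    · exact aux i j hij he
    · exact aux j i hij.symm he
  have hmem : wordAct G q (wsrc G p x) (al θ i) ∈ pairCone θ i j := by
    refine (mem_pairCone hij).2 ⟨hcone, fun k hki hkj => ?_⟩
    rw [wordAct_apply_of_notMem G (fun hk => (hq k hk).elim hki hkj)]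
    simp [al, hki]
  obtain ⟨a, b, hab⟩ := hmem
  rw [← (act_eq_of_wordMor_eq R hpq).1, wordAct_append, hab, map_add, map_smul, map_smul]
  exact add_nonneg (smul_nonneg (by positivity) (hpos i (Or.inl rfl)))
    (smul_nonneg (by positivity) (hpos j (Or.inr rfl)))

end Words

end WeylGroupoid
namespace WeylGroupoid

variable {θ : ℕ} {X : Type} [Fintype X] [DecidableEq X]

/-! ### Polynomials with nonnegative coefficients -/

/-- Nonzero polynomials with nonnegative coefficients. -/
def IsPosPoly (p : MvPolynomial (Fin θ) ℤ) : Prop := p ≠ 0 ∧ ∀ d, 0 ≤ MvPolynomial.coeff d p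

lemma isPosPoly_one : IsPosPoly (1 : MvPolynomial (Fin θ) ℤ) := by
  refine ⟨one_ne_zero, fun d => ?_⟩
  rw [MvPolynomial.coeff_one]
  split_ifs <;> simp

lemma IsPosPoly.mul {p q : MvPolynomial (Fin θ) ℤ} (hp : IsPosPoly p) (hq : IsPosPoly q) :
    IsPosPoly (p * q) := by
  refine ⟨mul_ne_zero hp.1 hq.1, fun d => ?_⟩
  rw [MvPolynomial.coeff_mul]
  exact Finset.sum_nonneg fun _ _ => mul_nonneg (hp.2 _) (hq.2 _)

lemma IsPosPoly.add_ne_zero {p q : MvPolynomial (Fin θ) ℤ} (hp : IsPosPoly p)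
    (hq : ∀ d, 0 ≤ MvPolynomial.coeff d q) : p + q ≠ 0 := by
  intro h
  refine hp.1 (MvPolynomial.ext _ _ fun d => ?_)
  have h1 := congrArg (MvPolynomial.coeff d) h
  rw [MvPolynomial.coeff_add, MvPolynomial.coeff_zero] at h1
  have := hp.2 d
  have := hq d
  rw [MvPolynomial.coeff_zero]
  omega

lemma coeff_lin (v : Fin θ → ℤ) (k : Fin θ) :
    MvPolynomial.coeff (Finsupp.single k 1) (lin v) = v k := by
  rw [lin, MvPolynomial.coeff_sum]
  simp_rw [MvPolynomial.coeff_C_mul, MvPolynomial.coeff_X]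
  simp [Finsupp.single_left_inj]

lemma isPosPoly_lin {v : Fin θ → ℤ} (h0 : 0 ≤ v) (hv : v ≠ 0) : IsPosPoly (lin v) := by
  constructor
  · intro h
    refine hv (funext fun k => ?_)
    rw [← coeff_lin v k, h]; simp
  · intro d
    rw [lin, MvPolynomial.coeff_sum]
    refine Finset.sum_nonneg fun k _ => ?_
    rw [MvPolynomial.coeff_C_mul, MvPolynomial.coeff_X]
    split_ifs
    · simpa using h0 k
    · simp

lemma lin_al (i : Fin θ) : lin (al θ i) = MvPolynomial.X i := by
  simp [lin, al, Pi.single_apply]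

section

variable (G : SCG θ X)

lemma sAct_lin (x : X) (i : Fin θ) (v : Fin θ → ℤ) :
    sAct G x i (lin v) = lin (srefl G x i v) := by
  have h : ∀ j, sAct G x i (MvPolynomial.X j) =
      MvPolynomial.X j - MvPolynomial.C (G.C x i j) * MvPolynomial.X i := fun j =>
    MvPolynomial.aeval_X _ j
  have hC : ∀ a : ℤ, sAct G x i (MvPolynomial.C a) = MvPolynomial.C a := fun a =>
    MvPolynomial.aeval_C _ a
  rw [srefl_eq]
  simp only [lin, map_sum, map_mul, h, hC, Pi.sub_apply, Pi.smul_apply, map_sub, sub_mul,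
    Finset.sum_sub_distrib, mul_sub]
  congr 1
  simp only [smul_eq_mul, map_mul, mul_assoc, ← Finset.mul_sum]
  have h2 := lin_al i
  rw [lin] at h2
  rw [h2, map_sum, Finset.sum_mul]
  exact Finset.sum_congr rfl fun k _ => by rw [map_mul]; ring

lemma sComp_X (w : List (Fin θ)) (x : X) (i : Fin θ) :
    sComp G w x (MvPolynomial.X i) = lin (wordAct G w x (al θ i)) := by
  induction w generalizing x with
  | nil => exact (lin_al i).symm
  | cons j l ih =>
    rw [sComp, RingHom.comp_apply, ih, sAct_lin]; rfl

/-! ### Expansion of the product -/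

/-- The good subwords of a word, with the corresponding products of linear polynomials. -/
def goodTerms : List (Fin θ) → X → (MvPolynomial (Fin θ) ℤ →+* MvPolynomial (Fin θ) ℤ) →
    List (MvPolynomial (Fin θ) ℤ × List (Fin θ))
  | [], _, _ => [(1, [])]
  | i :: l, x, s =>
    (if G.ρ i x = x then goodTerms l (G.ρ i x) (s.comp (sAct G x i)) else []) ++
      (goodTerms l (G.ρ i x) (s.comp (sAct G x i))).map
        fun p => (s (MvPolynomial.X i) * p.1, i :: p.2)

lemma wsrc_of_mem_goodTerms {w : List (Fin θ)} {x : X}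
    {s : MvPolynomial (Fin θ) ℤ →+* MvPolynomial (Fin θ) ℤ}
    {p : MvPolynomial (Fin θ) ℤ × List (Fin θ)} (hp : p ∈ goodTerms G w x s) :
    wsrc G p.2 x = wsrc G w x := by
  induction w generalizing x s p with
  | nil => rw [List.mem_singleton.1 hp]
  | cons i l ih =>
    rw [goodTerms, List.mem_append, List.mem_map] at hp
    rcases hp with hp | ⟨q, hq, rfl⟩
    · split_ifs at hp with h
      · rw [wsrc, ← ih hp, h]
      · simp at hp
    · exact ih hq

lemma isPosPoly_of_mem_goodTerms {w : List (Fin θ)} {x : X}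
    {s : MvPolynomial (Fin θ) ℤ →+* MvPolynomial (Fin θ) ℤ}
    (hs : ∀ (l : List (Fin θ)) (i : Fin θ) (r : List (Fin θ)), w = l ++ i :: r →
      IsPosPoly (s (sComp G l x (MvPolynomial.X i))))
    {p : MvPolynomial (Fin θ) ℤ × List (Fin θ)} (hp : p ∈ goodTerms G w x s) :
    IsPosPoly p.1 := by
  induction w generalizing x s p with
  | nil => rw [List.mem_singleton.1 hp]; exact isPosPoly_one
  | cons i l ih =>
    have ih' : ∀ q ∈ goodTerms G l (G.ρ i x) (s.comp (sAct G x i)), IsPosPoly q.1 :=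
      fun q hq => ih (fun l' j r h => hs (i :: l') j r (by rw [h]; rfl)) hq
    rw [goodTerms, List.mem_append, List.mem_map] at hp
    rcases hp with hp | ⟨q, hq, rfl⟩
    · split_ifs at hp with h
      · exact ih' _ hp
      · simp at hp
    · exact (hs [] i l rfl).mul (ih' _ hq)

/-- The good subwords of a word. -/
def goodSubwords : List (Fin θ) → X → Set (List (Fin θ))
  | [], _ => {[]}
  | i :: l, x => {v | G.ρ i x = x ∧ v ∈ goodSubwords l (G.ρ i x)} ∪
      (i :: ·) '' goodSubwords l (G.ρ i x)

lemma mem_goodSubwords_iff_exists_mem_goodTerms {w : List (Fin θ)} {x : X}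
    (s : MvPolynomial (Fin θ) ℤ →+* MvPolynomial (Fin θ) ℤ) {v : List (Fin θ)} :
    v ∈ goodSubwords G w x ↔ ∃ c, (c, v) ∈ goodTerms G w x s := by
  induction w generalizing x s v with
  | nil => simp [goodSubwords, goodTerms]
  | cons i l ih =>
    simp only [goodSubwords, goodTerms, Set.mem_union, Set.mem_ofPred_eq, Set.mem_image,
      List.mem_append, List.mem_map, Prod.mk.injEq, exists_or, ih (s.comp (sAct G x i)),
      Prod.exists]
    refine or_congr ?_ ⟨?_, ?_⟩
    · by_cases h : G.ρ i x = x <;> simp [h]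
    · rintro ⟨u, ⟨c, hc⟩, rfl⟩
      exact ⟨_, c, u, hc, rfl, rfl⟩
    · rintro ⟨_, c, u, hc, -, rfl⟩
      exact ⟨u, ⟨c, hc⟩, rfl⟩

end

lemma length_subword (w : List (Fin θ)) (S : Finset (Fin w.length)) :
    (subword w S).length = S.card := by
  rw [subword, List.length_map, ← List.toFinset_card_of_nodup ((List.nodup_finRange _).filter _)]
  congr 1
  ext k
  simp

lemma subword_cons (i : Fin θ) (l : List (Fin θ)) (S : Finset (Fin (i :: l).length)) :
    subword (i :: l) S = (if (0 : Fin (l.length + 1)) ∈ S then [i] else []) ++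
      subword l (Finset.univ.filter fun k => (Fin.succ k : Fin (l.length + 1)) ∈ S) := by
  have h : List.finRange (i :: l).length =
      (0 : Fin (l.length + 1)) :: (List.finRange l.length).map Fin.succ :=
    List.finRange_succ
  have h2 : (((List.finRange l.length).map Fin.succ).filter fun k => k ∈ S).map (i :: l).get =
      subword l (Finset.univ.filter fun k => (Fin.succ k : Fin (l.length + 1)) ∈ S) := by
    rw [List.filter_map, List.map_map, subword]
    simp only [Finset.mem_filter, Finset.mem_univ, true_and]
    rfl
  rw [subword, h, ← h2, List.filter_cons]
  split_ifs with h1 h3 h3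
  · rfl
  · exact absurd (of_decide_eq_true h1) h3
  · exact absurd (decide_eq_true h3) h1
  · rfl

lemma mem_goodSubwords_iff (G : SCG θ X) {w : List (Fin θ)} {x : X} {v : List (Fin θ)} :
    v ∈ goodSubwords G w x ↔ ∃ S : Finset (Fin w.length), IsGood G w x S ∧ subword w S = v := by
  induction w generalizing x v with
  | nil =>
    constructor
    · rintro rfl
      exact ⟨∅, fun z => z.elim0, rfl⟩
    · rintro ⟨S, -, rfl⟩
      rfl
  | cons i l ih =>
    have hgood : ∀ S : Finset (Fin (l.length + 1)), IsGood G (i :: l) x S ↔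
        ((0 : Fin (l.length + 1)) ∉ S → G.ρ i x = x) ∧
          IsGood G l (G.ρ i x) (Finset.univ.filter fun k => Fin.succ k ∈ S) := by
      intro S
      constructor
      · intro h
        refine ⟨fun h0 => h 0 h0, fun z hz => ?_⟩
        exact h z.succ (by simpa using hz)
      · rintro ⟨h0, h⟩ z
        refine Fin.cases (motive := fun z : Fin (l.length + 1) => z ∉ S →
          wsrc G ((i :: l).take ((z : ℕ) + 1)) x = wsrc G ((i :: l).take (z : ℕ)) x)
          h0 (fun z hz => ?_) z
        exact h z (by simpa using hz)
    have hfil : ∀ S : Finset (Fin l.length),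
        (Finset.univ.filter fun k => Fin.succ k ∈ S.map (Fin.succEmb l.length)) = S := by
      intro S; ext k; simp
    have hfil0 : ∀ S : Finset (Fin l.length),
        (Finset.univ.filter fun k => Fin.succ k ∈ insert 0 (S.map (Fin.succEmb l.length))) = S := by
      intro S; ext k; simp
    constructor
    · rintro (⟨hx, hv⟩ | ⟨u, hu, rfl⟩)
      · obtain ⟨S, hS, rfl⟩ := ih.1 hv
        refine ⟨S.map (Fin.succEmb l.length), (hgood _).2 ⟨fun _ => hx, ?_⟩, ?_⟩
        · rwa [hfil]
        · rw [subword_cons, hfil, if_neg (by simp), List.nil_append]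
      · obtain ⟨S, hS, rfl⟩ := ih.1 hu
        refine ⟨insert (0 : Fin (l.length + 1)) (S.map (Fin.succEmb l.length)),
          (hgood _).2 ⟨fun h => absurd (Finset.mem_insert_self _ _) h, ?_⟩, ?_⟩
        · rwa [hfil0]
        · rw [subword_cons, hfil0, if_pos (Finset.mem_insert_self _ _)]; rfl
    · rintro ⟨S, hS, rfl⟩
      obtain ⟨h0, h1⟩ := (hgood S).1 hS
      rw [subword_cons]
      split_ifs with h
      · exact Or.inr ⟨_, ih.2 ⟨_, h1, rfl⟩, rfl⟩
      · exact Or.inl ⟨h0 h, ih.2 ⟨_, h1, rfl⟩⟩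

section NilHecke

variable {G : SCG θ X} (R : GRS G) (𝕂 : Type) [CommRing 𝕂]

lemma sum_eN : ∑ x : X, eN G R 𝕂 x = 1 := by
  have h := RingQuot.mkAlgHom_rel 𝕂 (nrel.total (R := R) (𝕂 := 𝕂))
  rw [map_sum, map_one] at h
  exact h

lemma eN_mul_self (x : X) : eN G R 𝕂 x * eN G R 𝕂 x = eN G R 𝕂 x :=
  (map_mul (RingQuot.mkAlgHom 𝕂 (nrel G R 𝕂)) _ _).symm.trans
    (RingQuot.mkAlgHom_rel 𝕂 (nrel.idem x))

lemma eN_mul_nN (x : X) (i : Fin θ) : eN G R 𝕂 x * nN G R 𝕂 x i = nN G R 𝕂 x i :=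
  (map_mul (RingQuot.mkAlgHom 𝕂 (nrel G R 𝕂)) _ _).symm.trans
    (RingQuot.mkAlgHom_rel 𝕂 (nrel.unit_left x i))

lemma nN_mul_eN (x : X) (i : Fin θ) :
    nN G R 𝕂 x i * eN G R 𝕂 (G.ρ i x) = nN G R 𝕂 x i :=
  (map_mul (RingQuot.mkAlgHom 𝕂 (nrel G R 𝕂)) _ _).symm.trans
    (RingQuot.mkAlgHom_rel 𝕂 (nrel.unit_right x i))

lemma nN_mul_nN (x : X) (i : Fin θ) : nN G R 𝕂 x i * nN G R 𝕂 (G.ρ i x) i = 0 := by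
  have h := RingQuot.mkAlgHom_rel 𝕂 (nrel.nil (R := R) (𝕂 := 𝕂) (G.ρ i x) i)
  rw [G.invol, map_mul, map_zero] at h
  exact h

lemma nW_nil (x : X) : nW G R 𝕂 [] x = 1 := map_one (RingQuot.mkAlgHom 𝕂 (nrel G R 𝕂))

lemma nW_cons (i : Fin θ) (l : List (Fin θ)) (x : X) :
    nW G R 𝕂 (i :: l) x = nN G R 𝕂 x i * nW G R 𝕂 l (G.ρ i x) :=
  map_mul (RingQuot.mkAlgHom 𝕂 (nrel G R 𝕂)) _ _

lemma eN_mul_nW_cons (i : Fin θ) (l : List (Fin θ)) (x : X) :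
    eN G R 𝕂 x * nW G R 𝕂 (i :: l) x =
      nN G R 𝕂 x i * (eN G R 𝕂 (G.ρ i x) * nW G R 𝕂 l (G.ρ i x)) := by
  rw [nW_cons, ← mul_assoc, ← mul_assoc, eN_mul_nN, nN_mul_eN]

/-- Expansion of the product of the `h_i` over good subwords. -/
lemma eN_mul_hP (w : List (Fin θ)) (x : X)
    (s : MvPolynomial (Fin θ) ℤ →+* MvPolynomial (Fin θ) ℤ) :
    eN G R _ x * hP G R w x s =
      ((goodTerms G w x s).map fun p => p.1 • (eN G R _ x * nW G R _ p.2 x)).sum := by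
  induction w generalizing x s with
  | nil => simp [hP, goodTerms, nW_nil]
  | cons i l ih =>
    have h1 : nN G R (MvPolynomial (Fin θ) ℤ) x i * hP G R l (G.ρ i x) (s.comp (sAct G x i)) =
        ((goodTerms G l (G.ρ i x) (s.comp (sAct G x i))).map fun p =>
          p.1 • (eN G R _ x * nW G R _ (i :: p.2) x)).sum := by
      rw [← nN_mul_eN, mul_assoc, ih, ← List.sum_map_mul_left]
      simp only [mul_smul_comm, eN_mul_nW_cons]
    have h2 : ((goodTerms G l (G.ρ i x) (s.comp (sAct G x i))).map fun p =>
          (s (MvPolynomial.X i) * p.1) • (eN G R _ x * nW G R _ (i :: p.2) x)).sum =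
        s (MvPolynomial.X i) • (nN G R (MvPolynomial (Fin θ) ℤ) x i *
          hP G R l (G.ρ i x) (s.comp (sAct G x i))) := by
      rw [h1, List.smul_sum, List.map_map]
      simp only [Function.comp_def, mul_smul]
    rw [hP, hGen, goodTerms, List.map_append, List.sum_append, List.map_map]
    simp only [Function.comp_def]
    rw [h2]
    split_ifs with h
    · rw [← mul_assoc, mul_add, mul_smul_comm, eN_mul_self, eN_mul_nN, add_mul, smul_mul_assoc]
      congr 1
      have := ih (G.ρ i x) (s.comp (sAct G x i))
      rwa [h] at this ⊢
    · rw [← mul_assoc, mul_smul_comm, eN_mul_nN, smul_mul_assoc]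
      simp

lemma eN_mul_hGen (x : X) (i : Fin θ) (t : MvPolynomial (Fin θ) ℤ) :
    eN G R _ x * hGen G R x i t = hGen G R x i t := by
  unfold hGen
  split_ifs
  · rw [mul_add, mul_smul_comm, eN_mul_self, eN_mul_nN]
  · rw [mul_smul_comm, eN_mul_nN]

lemma eN_mul_hP_of_ne_nil {w : List (Fin θ)} (hw : w ≠ []) (x : X)
    (s : MvPolynomial (Fin θ) ℤ →+* MvPolynomial (Fin θ) ℤ) :
    eN G R _ x * hP G R w x s = hP G R w x s := by
  obtain ⟨i, l, rfl⟩ := List.exists_cons_of_ne_nil hw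
  rw [hP, ← mul_assoc, eN_mul_hGen]

end NilHecke

end WeylGroupoid

namespace WeylGroupoid

variable {θ : ℕ} {X : Type} [Fintype X] [DecidableEq X] {G : SCG θ X} (R : GRS G)
variable {𝕂 : Type} [CommRing 𝕂] {T : ∀ y x : X, homW G R y x → NH G R 𝕂}

/-! ### The standard elements `T_w` -/

section

variable (hT : ∀ (y x : X) (f : homW G R y x) (w : List (Fin θ)) (h : wsrc G w x = y),
  castW G R h (morW G R w x) = f → w.length = len G R f → 0 < w.length →
  T y x f = nW G R 𝕂 w x)
include hT

lemma T_eq_nW {v : List (Fin θ)} {x y : X} {u : homW G R y x} (hv : IsReducedWord R v x)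
    (hu : wordMor R v x = ⟨y, u⟩) (hne : v ≠ []) : T y x u = nW G R 𝕂 v x := by
  obtain ⟨h, h'⟩ := (exists_castW_eq_iff R).2 hu
  exact hT y x u v h h' ((isReducedWord_iff R hu).1 hv) (List.length_pos_iff.2 hne)

lemma nW_eq_zero {w : List (Fin θ)} {x : X} (hw : ¬ IsReducedWord R w x) :
    nW G R 𝕂 w x = 0 := by
  induction w generalizing x with
  | nil => exact absurd (isReducedWord_nil x) hw
  | cons i l ih =>
    by_cases hl : IsReducedWord R l (G.ρ i x)
    · obtain ⟨v, hlen, hv⟩ := exists_of_not_isReducedWord_cons hw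
      have hiv : IsReducedWord R (i :: v) (G.ρ i x) := hl.congr hv hlen
      have hne : l ≠ [] := List.ne_nil_of_length_pos (by omega)
      rw [nW_cons, ← T_eq_nW R hT hl rfl hne, T_eq_nW R hT hiv hv (List.cons_ne_nil _ _),
        nW_cons, ← mul_assoc, nN_mul_nN, zero_mul]
    · rw [nW_cons, ih hl, mul_zero]

variable (hTid : ∀ x : X, T x x (𝟙 (objW G R x)) = eN G R 𝕂 x)
include hTid

lemma eN_mul_nW_eq_T {v : List (Fin θ)} {x y : X} {u : homW G R y x}
    (hv : IsReducedWord R v x) (hu : wordMor R v x = ⟨y, u⟩) :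
    eN G R 𝕂 x * nW G R 𝕂 v x = T y x u := by
  cases v with
  | nil =>
    cases hu
    rw [nW_nil, mul_one]
    refine (hTid x).symm.trans (congrArg (T x x) ?_)
    exact ((Quotient.functor (wrel G R)).map_id _).symm
  | cons i l =>
    rw [T_eq_nW R hT hv hu (List.cons_ne_nil _ _), nW_cons, ← mul_assoc, eN_mul_nN]

end

/-- A combination of words with positive coefficients is a combination of the `T_u` with
nonnegative coefficients, supported exactly on the morphisms having a reduced expression among
these words. -/
lemma exists_finsupp_of_words {T : ∀ y x : X, homW G R y x → NH G R (MvPolynomial (Fin θ) ℤ)}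
    (hT : ∀ (y x : X) (f : homW G R y x) (w : List (Fin θ)) (h : wsrc G w x = y),
      castW G R h (morW G R w x) = f → w.length = len G R f → 0 < w.length →
      T y x f = nW G R (MvPolynomial (Fin θ) ℤ) w x)
    (hTid : ∀ x : X, T x x (𝟙 (objW G R x)) = eN G R (MvPolynomial (Fin θ) ℤ) x)
    {x y : X} (ts : List (MvPolynomial (Fin θ) ℤ × List (Fin θ)))
    (hts : ∀ p ∈ ts, wsrc G p.2 x = y ∧ IsPosPoly p.1) :
    ∃ f : homW G R y x →₀ MvPolynomial (Fin θ) ℤ,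
      (ts.map fun p => p.1 • (eN G R _ x * nW G R _ p.2 x)).sum =
        f.sum (fun u c => c • T y x u) ∧
      (∀ u, u ∈ f.support ↔ ∃ p ∈ ts, IsReducedWord R p.2 x ∧ wordMor R p.2 x = ⟨y, u⟩) ∧
      ∀ u d, 0 ≤ MvPolynomial.coeff d (f u) := by
  induction ts with
  | nil => exact ⟨0, by simp, by simp, by simp⟩
  | cons p ts ih =>
    obtain ⟨f, hsum, hsupp, hnn⟩ := ih fun q hq => hts q (List.mem_cons_of_mem _ hq)
    obtain ⟨hy, hp⟩ := hts p List.mem_cons_self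
    by_cases hr : IsReducedWord R p.2 x
    · have hu₀ := (exists_castW_eq_iff R).1 ⟨hy, rfl⟩
      set u₀ := castW G R hy (morW G R p.2 x)
      refine ⟨Finsupp.single u₀ p.1 + f, ?_, fun u => ?_, fun u d => ?_⟩
      · rw [List.map_cons, List.sum_cons, hsum, eN_mul_nW_eq_T R hT hTid hr hu₀,
          Finsupp.sum_add_index' (h := fun u c => c • T y x u) (fun _ => zero_smul _ _)
            (fun _ _ _ => add_smul _ _ _),
          Finsupp.sum_single_index (h := fun u c => c • T y x u) (zero_smul _ _)]
      · by_cases hu : u₀ = u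
        · subst hu
          simp only [Finsupp.mem_support_iff, Finsupp.add_apply, Finsupp.single_eq_same]
          exact iff_of_true (hp.add_ne_zero (hnn _)) ⟨p, List.mem_cons_self, hr, hu₀⟩
        · have hne : wordMor R p.2 x ≠ ⟨y, u⟩ := fun h =>
            hu (eq_of_heq (Sigma.mk.inj (hu₀.symm.trans h)).2)
          have hsupp' := hsupp u
          rw [Finsupp.mem_support_iff] at hsupp'
          simp [Finsupp.single_eq_of_ne (Ne.symm hu), hsupp', hne]
      · rw [Finsupp.add_apply, MvPolynomial.coeff_add]
        refine add_nonneg ?_ (hnn u d)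
        classical
        rw [Finsupp.single_apply]
        split_ifs
        · exact hp.2 d
        · simp
    · refine ⟨f, ?_, fun u => ?_, hnn⟩
      · rw [List.map_cons, List.sum_cons, nW_eq_zero R hT hr, mul_zero, smul_zero, zero_add, hsum]
      · rw [hsupp, List.exists_mem_cons_iff]
        exact (or_iff_right fun h => hr h.1).symm

/-- Each linear factor in the expansion along a reduced word is a positive root. -/
lemma IsReducedWord.isPosPoly_sComp_X {l r : List (Fin θ)} {i : Fin θ} {x : X}
    (h : IsReducedWord R (l ++ i :: r) x) :
    IsPosPoly (sComp G l x (MvPolynomial.X i)) := by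
  rw [sComp_X]
  refine isPosPoly_lin (IsReducedWord.wordAct_al_nonneg (R := R) (i := i) ?_)
    (R.ne_zero (R.wordAct_mem_iff.2 (R.al_mem _ i)) i)
  refine IsReducedWord.of_append_left (q := r) ?_
  rwa [List.append_assoc]

lemma mem_Theta_iff {w : List (Fin θ)} {x : X} {u : homW G R (wsrc G w x) x} :
    u ∈ Theta G R w x ↔ ∃ v ∈ goodSubwords G w x,
      IsReducedWord R v x ∧ wordMor R v x = ⟨wsrc G w x, u⟩ := by
  constructor
  · rintro ⟨S, hS, hlen, h⟩
    have hu := (exists_castW_eq_iff R).1 h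
    exact ⟨_, (mem_goodSubwords_iff G).2 ⟨S, hS, rfl⟩,
      (isReducedWord_iff R hu).2 ((length_subword w S).trans hlen), hu⟩
  · rintro ⟨v, hv, hr, hu⟩
    obtain ⟨S, hS, rfl⟩ := (mem_goodSubwords_iff G).1 hv
    exact ⟨S, hS, (length_subword w S).symm.trans ((isReducedWord_iff R hu).1 hr),
      (exists_castW_eq_iff R).2 hu⟩

end WeylGroupoid

namespace WeylGroupoid

/-- **Expansion of `Ψ(σ̃_{i_1}^x ⋯ σ̃_{i_r})(1)` over good subsequences.**
Let `w ∈ 𝒲(y,x)` with reduced expression `σ_{i_1}^{x_1} ⋯ σ_{i_r}^{x_r}` (`r > 0`).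
Then `Ψ(σ̃_{i_1}^x ⋯ σ̃_{i_r})(1) = Σ_{u ∈ Θ(x; i_1,…,i_r)} f_u T_u`, where each `f_u` is
a nonzero polynomial with nonnegative coefficients; in particular `Θ(x; i_1,…,i_r)` is
exactly the set of `u` for which `T_u` appears with nonzero coefficient. -/
theorem Psi_one_expansion {θ : ℕ} {X : Type} [Fintype X] [DecidableEq X]
    (G : SCG θ X) (R : GRS G)
    (T : ∀ y x : X, homW G R y x → NH G R (MvPolynomial (Fin θ) ℤ))
    (hT : ∀ (y x : X) (f : homW G R y x) (w : List (Fin θ)) (h : wsrc G w x = y),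
      castW G R h (morW G R w x) = f → w.length = len G R f → 0 < w.length →
      T y x f = nW G R (MvPolynomial (Fin θ) ℤ) w x)
    (hTid : ∀ x : X, T x x (𝟙 (objW G R x)) = eN G R (MvPolynomial (Fin θ) ℤ) x)
    (Ψ : ∀ y x : X, homWt G R y x →
      (NH G R (MvPolynomial (Fin θ) ℤ) →ₗ[ℤ] NH G R (MvPolynomial (Fin θ) ℤ)))
    (hΨ : ∀ (w : List (Fin θ)) (x : X) (f : MvPolynomial (Fin θ) ℤ)
        (y' x' : X) (v : homW G R y' x'),
      Ψ (wsrc G w x) x (morWt G R w x) (f • T y' x' v) =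
        hP G R w x (RingHom.id _) * ((sComp G w x f) • T y' x' v))
    (x : X) (w : List (Fin θ)) (hpos : 0 < w.length)
    (hred : w.length = len G R (morW G R w x)) :
    ∃ f : homW G R (wsrc G w x) x →₀ MvPolynomial (Fin θ) ℤ,
      Ψ (wsrc G w x) x (morWt G R w x) 1 =
        f.sum (fun u c => c • T (wsrc G w x) x u) ∧
      (↑f.support : Set (homW G R (wsrc G w x) x)) = Theta G R w x ∧
      (∀ (u : homW G R (wsrc G w x) x) (dm : Fin θ →₀ ℕ),
        0 ≤ MvPolynomial.coeff dm (f u)) := by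
  have hw : w ≠ [] := List.ne_nil_of_length_pos hpos
  have hred' : IsReducedWord R w x := (isReducedWord_iff R rfl).2 hred
  have hone : ∑ x' : X, T x' x' (𝟙 (objW G R x')) = 1 := by
    simp only [hTid, sum_eN]
  have hval : Ψ (wsrc G w x) x (morWt G R w x) 1 = hP G R w x (RingHom.id _) := by
    have h : ∀ x' : X, Ψ (wsrc G w x) x (morWt G R w x) (T x' x' (𝟙 (objW G R x'))) =
        hP G R w x (RingHom.id _) * T x' x' (𝟙 (objW G R x')) := fun x' => by
      have := hΨ w x 1 x' x' (𝟙 (objW G R x'))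
      rwa [map_one, one_smul] at this
    rw [← hone, map_sum, Finset.sum_congr rfl fun x' _ => h x', ← Finset.mul_sum, hone, mul_one]
  obtain ⟨f, hsum, hsupp, hnn⟩ := exists_finsupp_of_words R hT hTid
    (goodTerms G w x (RingHom.id _)) fun p hp => ⟨wsrc_of_mem_goodTerms G hp,
      isPosPoly_of_mem_goodTerms G (fun l i r h => by
        subst h; exact hred'.isPosPoly_sComp_X R) hp⟩
  refine ⟨f, ?_, Set.ext fun u => ?_, hnn⟩
  · rw [hval, ← hsum, ← eN_mul_hP, eN_mul_hP_of_ne_nil R hw]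
  · rw [Finset.mem_coe, hsupp, mem_Theta_iff]
    simp only [mem_goodSubwords_iff_exists_mem_goodTerms G (RingHom.id _)]
    exact ⟨fun ⟨p, hp, h⟩ => ⟨p.2, ⟨p.1, hp⟩, h⟩, fun ⟨v, ⟨c, hc⟩, h⟩ => ⟨(c, v), hc, h⟩⟩

end WeylGroupoid
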